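/- arXiv:1307.4478 — 2 statements merged into one kernel-verified Lean document; each statement's English description precedes it below -/
import Mathlib

section
/- The satisfiability problem for ATL_sc^0 (ATL with strategy contexts in which strategy quantifiers range over memoryless strategies) is undecidable, even when the input formula is required to be satisfied in a turn-based game structure: there is no algorithm that, given an ATL_sc^0 formula, decides whether there exists a turn-based concurrent game structure and a state of it satisfying the formula under the empty strategy context. -/
/-!
# ATL with strategy contexts and memoryless strategies (ATL_sc^0)

Players and atomic propositions are coded as natural numbers.
-/

/-- A concurrent game structure: states labelled with atomic propositions (coded as
naturals), players coded as naturals, and a transition function assigning to each state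
and each tuple of moves (one move per player) a successor state. -/
structure CGS : Type 1 where
  State : Type
  Move : Type
  move_nonempty : Nonempty Move
  label : State → ℕ → Prop
  trans : State → (ℕ → Move) → State

/-- Player `p` controls state `s`: the successor from `s` only depends on `p`'s move. -/
def Controls (G : CGS) (p : ℕ) (s : G.State) : Prop :=
  ∀ mv mv' : ℕ → G.Move, mv p = mv' p → G.trans s mv = G.trans s mv'

/-- A game structure is turn-based if every state is controlled by a single player. -/
def TurnBased (G : CGS) : Prop := ∀ s : G.State, ∃ p : ℕ, Controls G p s

/-- A (memoryless) strategy context: a partial assignment of memoryless strategies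
(functions from states to moves) to players. -/
def Ctx (G : CGS) : Type := ℕ → Option (G.State → G.Move)

/-- The empty strategy context. -/
def emptyCtx (G : CGS) : Ctx G := fun _ => none

/-- `π` is an outcome from state `s` compatible with the memoryless context `ctx`:
at each step, every player to whom `ctx` assigns a strategy plays according to it. -/
def IsOutcome (G : CGS) (ctx : Ctx G) (s : G.State) (π : ℕ → G.State) : Prop :=
  π 0 = s ∧ ∀ i : ℕ, ∃ mv : ℕ → G.Move,
    (∀ p σ, ctx p = some σ → mv p = σ (π i)) ∧ π (i + 1) = G.trans (π i) mv

/-- Formulas of ATL_sc^0 (with LTL path modalities `X` and `U`); coalitions are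
finite lists of players. -/
inductive Formula : Type where
  | atom : ℕ → Formula
  | neg : Formula → Formula
  | conj : Formula → Formula → Formula
  | next : Formula → Formula
  | untl : Formula → Formula → Formula
  | strat : List ℕ → Formula → Formula

/-- Satisfaction of a formula on a path, under a memoryless strategy context.
`strat A φ` (the quantifier `⟨A⟩φ`) assigns new memoryless strategies to the players
of `A`, keeps the strategies of the other players from the current context, and
requires `φ` on all outcomes compatible with the resulting context. -/
def sat (G : CGS) : Formula → Ctx G → (ℕ → G.State) → Prop
  | .atom p, _, π => G.label (π 0) p
  | .neg φ, ctx, π => ¬ sat G φ ctx π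
  | .conj φ ψ, ctx, π => sat G φ ctx π ∧ sat G ψ ctx π
  | .next φ, ctx, π => sat G φ ctx (fun n => π (n + 1))
  | .untl φ ψ, ctx, π => ∃ j : ℕ, sat G ψ ctx (fun n => π (n + j)) ∧
      ∀ k < j, sat G φ ctx (fun n => π (n + k))
  | .strat A φ, ctx, π => ∃ ctx' : Ctx G,
      (∀ p, p ∉ A → ctx' p = ctx p) ∧
      (∀ p, p ∈ A → ∃ σ, ctx' p = some σ) ∧
      ∀ π' : ℕ → G.State, IsOutcome G ctx' (π 0) π' → sat G φ ctx' π'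

/-- A state satisfies a formula (under a given context) if the formula holds on all
outcomes from that state compatible with the context. -/
def StateSatCtx (G : CGS) (ctx : Ctx G) (s : G.State) (φ : Formula) : Prop :=
  ∀ π : ℕ → G.State, IsOutcome G ctx s π → sat G φ ctx π

/-- A state satisfies a formula under the empty strategy context. -/
def StateSat (G : CGS) (s : G.State) (φ : Formula) : Prop :=
  StateSatCtx G (emptyCtx G) s φ

/-- Satisfiability of an ATL_sc^0 formula in a turn-based game structure. -/
def SatTB (φ : Formula) : Prop :=
  ∃ G : CGS, TurnBased G ∧ ∃ s : G.State, StateSat G s φ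

/-- An explicit injective encoding of formulas as natural numbers. -/
def encodeF : Formula → ℕ
  | .atom n => Nat.pair 0 n
  | .neg φ => Nat.pair 1 (encodeF φ)
  | .conj φ ψ => Nat.pair 2 (Nat.pair (encodeF φ) (encodeF ψ))
  | .next φ => Nat.pair 3 (encodeF φ)
  | .untl φ ψ => Nat.pair 4 (Nat.pair (encodeF φ) (encodeF ψ))
  | .strat A φ => Nat.pair 5 (Nat.pair (Encodable.encode A) (encodeF φ))

namespace ATLsc

/-! ### State formulas and full contexts -/

/-- Formulas whose truth on a path only depends on its first state. -/
def IsStateFormula : Formula → Prop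
  | .atom _ => True
  | .neg φ => IsStateFormula φ
  | .conj φ ψ => IsStateFormula φ ∧ IsStateFormula ψ
  | .next _ => False
  | .untl _ _ => False
  | .strat _ _ => True

theorem sat_congr_head {G : CGS} {φ : Formula} (hφ : IsStateFormula φ) {ctx : Ctx G}
    {π π' : ℕ → G.State} (h : π 0 = π' 0) : sat G φ ctx π ↔ sat G φ ctx π' := by
  induction φ with
  | atom p => simp [sat, h]
  | neg φ ih => simp [sat, ih hφ]
  | conj φ ψ ih₁ ih₂ => simp [sat, ih₁ hφ.1, ih₂ hφ.2]
  | next φ => exact hφ.elim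
  | untl φ ψ => exact hφ.elim
  | strat A φ => simp [sat, h]

theorem exists_isOutcome (G : CGS) (ctx : Ctx G) (s : G.State) :
    ∃ π : ℕ → G.State, IsOutcome G ctx s π := by
  obtain ⟨m⟩ := G.move_nonempty
  let step : G.State → G.State := fun t => G.trans t fun p => (ctx p).elim m fun σ => σ t
  refine ⟨fun n => step^[n] s, rfl, fun i => ⟨_, ?_, Function.iterate_succ_apply' step i s⟩⟩
  intro p σ h
  simp [h]

/-- The number of variables of the encoded first-order theory. -/
abbrev numVars : ℕ := 10

/-- The number of players that occur in the formulas: a selector `0`, a marker `1`, a player `2`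
choosing facts, and one player for each variable. -/
abbrev numPlayers : ℕ := numVars + 3

/-- Memoryless strategies. -/
abbrev Strategy (G : CGS) : Type := G.State → G.Move

/-- The context in which exactly the first `numPlayers` players have a strategy. -/
def fullCtx (G : CGS) (a : ℕ → Strategy G) : Ctx G :=
  fun p => if p < numPlayers then some (a p) else none

/-- Truth of a state formula at `s` in a full context. -/
def Holds (G : CGS) (s : G.State) (a : ℕ → Strategy G) (φ : Formula) : Prop :=
  sat G φ (fullCtx G a) fun _ => s

section Holds

variable {G : CGS} {s : G.State} {a : ℕ → Strategy G} {φ ψ : Formula}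

theorem sat_strat_iff {A : List ℕ} (hφ : IsStateFormula φ) {ctx : Ctx G} {π : ℕ → G.State} :
    sat G (.strat A φ) ctx π ↔ ∃ ctx' : Ctx G, (∀ p, p ∉ A → ctx' p = ctx p) ∧
      (∀ p, p ∈ A → ∃ σ, ctx' p = some σ) ∧ sat G φ ctx' fun _ => π 0 := by
  simp only [sat]
  refine exists_congr fun ctx' => and_congr_right fun _ => and_congr_right fun _ => ?_
  constructor
  · intro h
    obtain ⟨π', hπ'⟩ := exists_isOutcome G ctx' (π 0)
    exact (sat_congr_head (π' := fun _ => π 0) hφ hπ'.1).1 (h π' hπ')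
  · intro h π' hπ'
    exact (sat_congr_head (π' := fun _ => π 0) hφ hπ'.1).2 h

@[simp]
theorem holds_neg : Holds G s a (.neg φ) ↔ ¬ Holds G s a φ := Iff.rfl

@[simp]
theorem holds_conj : Holds G s a (.conj φ ψ) ↔ Holds G s a φ ∧ Holds G s a ψ := Iff.rfl

theorem holds_strat {A : List ℕ} (hA : ∀ p ∈ A, p < numPlayers) (hφ : IsStateFormula φ) :
    Holds G s a (.strat A φ) ↔
      ∃ a' : ℕ → Strategy G, (∀ p < numPlayers, p ∉ A → a' p = a p) ∧ Holds G s a' φ := by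
  rw [Holds, sat_strat_iff hφ]
  constructor
  · rintro ⟨ctx', h₁, h₂, h₃⟩
    have key : ∀ p, ctx' p = fullCtx G (fun p => (ctx' p).getD (a p)) p := by
      intro p
      by_cases hp : p ∈ A
      · obtain ⟨σ, hσ⟩ := h₂ p hp
        simp [fullCtx, hA p hp, hσ]
      · by_cases hlt : p < numPlayers <;> simp [fullCtx, h₁ p hp, hlt]
    refine ⟨fun p => (ctx' p).getD (a p), fun p hlt hp => ?_, ?_⟩
    · simp [h₁ p hp, fullCtx, hlt]
    · rw [Holds, ← funext key]
      exact h₃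
  · rintro ⟨a', h₁, h₂⟩
    refine ⟨fullCtx G a', fun p hp => ?_, fun p hp => ⟨a' p, by simp [fullCtx, hA p hp]⟩, h₂⟩
    by_cases hlt : p < numPlayers
    · simp [fullCtx, hlt, h₁ p hlt hp]
    · simp [fullCtx, hlt]

/-- Changing strategies outside the relevant players is invisible. -/
theorem holds_congr {a' : ℕ → Strategy G} (h : ∀ p < numPlayers, a p = a' p) :
    Holds G s a φ ↔ Holds G s a' φ := by
  have : fullCtx G a = fullCtx G a' := by
    funext p
    by_cases hlt : p < numPlayers
    · simp [fullCtx, hlt, h p hlt]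
    · simp [fullCtx, hlt]
  rw [Holds, this, Holds]

theorem holds_strat_singleton {p : ℕ} (hp : p < numPlayers) (hφ : IsStateFormula φ) :
    Holds G s a (.strat [p] φ) ↔ ∃ σ, Holds G s (Function.update a p σ) φ := by
  rw [holds_strat (by simpa using hp) hφ]
  constructor
  · rintro ⟨a', h, h'⟩
    refine ⟨a' p, (holds_congr fun q hq => ?_).1 h'⟩
    by_cases hqp : q = p
    · subst hqp; simp
    · simp [hqp, h q hq (by simpa using hqp)]
  · rintro ⟨σ, h⟩
    refine ⟨_, fun q _ hqp => ?_, h⟩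
    exact Function.update_of_ne (by simpa using hqp) _ _

/-- `φ` holds whatever the players outside `S` play. -/
def box (S : List ℕ) (φ : Formula) : Formula :=
  .neg (.strat ((List.range numPlayers).filter (· ∉ S)) (.neg φ))

theorem holds_box {S : List ℕ} (hφ : IsStateFormula φ) :
    Holds G s a (box S φ) ↔
      ∀ a' : ℕ → Strategy G, (∀ p ∈ S, a' p = a p) → Holds G s a' φ := by
  rw [box, holds_neg, holds_strat (φ := φ.neg) (by simp +contextual) hφ]
  push Not
  constructor
  · intro h a' ha'
    have h₁ := h (fun p => if p < numPlayers then a' p else a p) (fun p hp hpS => by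
      have : p ∈ S := by simpa [hp] using hpS
      simp [hp, ha' p this])
    rw [holds_neg, not_not] at h₁
    exact (holds_congr fun p hp => by simp [hp]).1 h₁
  · intro h a' ha'
    rw [holds_neg, not_not]
    refine (holds_congr (a := fun p => if p < numPlayers then a' p else a p)
      fun p hp => by simp [hp]).1 (h _ fun p hp => ?_)
    by_cases hlt : p < numPlayers
    · simp [hlt, ha' p hlt (by simp [hp])]
    · simp [hlt]

/-- `φ` holds in all full contexts, expressed from the empty context. -/
def always (φ : Formula) : Formula := .neg (.strat (List.range numPlayers) (.neg φ))

theorem stateSat_always (hφ : IsStateFormula φ) :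
    StateSat G s (always φ) ↔ ∀ a, Holds G s a φ := by
  have h₁ : StateSat G s (always φ) ↔ sat G (always φ) (emptyCtx G) fun _ => s := by
    constructor
    · intro h
      obtain ⟨π, hπ⟩ := exists_isOutcome G (emptyCtx G) s
      exact (sat_congr_head (φ := always φ) trivial hπ.1).1 (h π hπ)
    · intro h π hπ
      exact (sat_congr_head (φ := always φ) trivial hπ.1).2 h
  rw [h₁, always, sat, sat_strat_iff (φ := φ.neg) hφ]
  push Not
  constructor
  · intro h a
    have h₂ := h (fullCtx G a) (fun p hp => ?_) (fun p hp => ?_)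
    · rwa [sat, not_not] at h₂
    · have : ¬ p < numPlayers := by simpa using hp
      simp [fullCtx, emptyCtx, this]
    · have : p < numPlayers := by simpa using hp
      exact ⟨a p, by simp [fullCtx, this]⟩
  · intro h ctx h₂ h₃
    obtain ⟨m⟩ := G.move_nonempty
    have key : ctx = fullCtx G fun p => (ctx p).getD fun _ => m := by
      funext p
      by_cases hp : p < numPlayers
      · obtain ⟨σ, hσ⟩ := h₃ p (by simpa using hp)
        simp [fullCtx, hp, hσ]
      · rw [h₂ p (by simpa using hp)]
        simp [fullCtx, hp, emptyCtx]
    rw [sat, not_not, key]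
    exact h _

end Holds

/-! ### Formulas for terms, equality and facts -/

section Atoms

/-- The element denoted by variable `j` is marked. -/
def varMarked (j : Fin numVars) : Formula :=
  .strat [0] (.next (.conj (.atom (j + 3)) (.next (.next (.atom 0)))))

/-- The `i`-th component of the fact chosen by player `2` is marked. -/
def componentMarked (i : ℕ) : Formula :=
  .strat [0] (.next (.conj (.atom 2) (.next (.next
    (.conj (.atom i) (.next (.next (.atom 0))))))))

/-- The fact chosen by player `2` is labelled `R`. -/
def factLabelled (R : ℕ) : Formula :=
  .strat [0] (.next (.conj (.atom 2) (.next (.atom R))))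

/-- `φ` and `ψ` are equivalent for every strategy of the marker. -/
def sameMarks (φ ψ : Formula) : Formula :=
  .neg (.strat [1] (.neg
    (.conj (.neg (.conj φ (.neg ψ))) (.neg (.conj ψ (.neg φ))))))

/-- The boxed version of `varMarked`. -/
def varTerm (j : Fin numVars) : Formula := box [j + 3, 1] (varMarked j)

/-- The boxed version of `componentMarked`. -/
def componentTerm (i : ℕ) : Formula := box [2, 1] (componentMarked i)

/-- The fact `R(i, j, k)` holds, for variables `i`, `j`, `k`. -/
def factFormula (R : ℕ) (i j k : Fin numVars) : Formula :=
  .strat [2] (.conj (box [2] (factLabelled R))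
    (.conj (sameMarks (varTerm i) (componentTerm 0))
      (.conj (sameMarks (varTerm j) (componentTerm 1))
        (sameMarks (varTerm k) (componentTerm 2)))))

variable (G : CGS) (s : G.State)

/-- The set of marker strategies that mark the value of variable `j` under strategy `σ`. -/
def varDen (j : Fin numVars) (σ : Strategy G) : Set (Strategy G) :=
  {τ | ∀ a, a (j + 3) = σ → a 1 = τ → Holds G s a (varMarked j)}

/-- The set of marker strategies that mark the `i`-th component of the fact chosen by `σ`. -/
def componentDen (i : ℕ) (σ : Strategy G) : Set (Strategy G) :=
  {τ | ∀ a, a 2 = σ → a 1 = τ → Holds G s a (componentMarked i)}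

/-- The fact chosen by `σ` is labelled `R`. -/
def FactLabel (R : ℕ) (σ : Strategy G) : Prop :=
  ∀ a, a 2 = σ → Holds G s a (factLabelled R)

variable {G s} {a : ℕ → Strategy G}

theorem holds_sameMarks {φ ψ : Formula} (hφ : IsStateFormula φ) (hψ : IsStateFormula ψ) :
    Holds G s a (sameMarks φ ψ) ↔ ∀ τ, (Holds G s (Function.update a 1 τ) φ ↔
      Holds G s (Function.update a 1 τ) ψ) := by
  rw [sameMarks, holds_neg, holds_strat_singleton (p := 1) (by norm_num)]
  · simp only [holds_neg, holds_conj, not_exists, not_not]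
    exact forall_congr' fun τ => by tauto
  · exact ⟨⟨hφ, hψ⟩, hψ, hφ⟩

theorem holds_varTerm (j : Fin numVars) :
    Holds G s a (varTerm j) ↔ a 1 ∈ varDen G s j (a (j + 3)) := by
  rw [varTerm, holds_box (φ := varMarked j) trivial]
  simp [varDen]

theorem holds_componentTerm (i : ℕ) :
    Holds G s a (componentTerm i) ↔ a 1 ∈ componentDen G s i (a 2) := by
  rw [componentTerm, holds_box (φ := componentMarked i) trivial]
  simp [componentDen]

theorem holds_var_eq_component (j : Fin numVars) (i : ℕ) :
    Holds G s a (sameMarks (varTerm j) (componentTerm i)) ↔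
      varDen G s j (a (j + 3)) = componentDen G s i (a 2) := by
  rw [holds_sameMarks (φ := varTerm j) (ψ := componentTerm i) trivial trivial, Set.ext_iff]
  simp [holds_varTerm, holds_componentTerm]

theorem holds_var_eq_var (j j' : Fin numVars) :
    Holds G s a (sameMarks (varTerm j) (varTerm j')) ↔
      varDen G s j (a (j + 3)) = varDen G s j' (a (j' + 3)) := by
  rw [holds_sameMarks (φ := varTerm j) (ψ := varTerm j') trivial trivial, Set.ext_iff]
  simp [holds_varTerm]

theorem holds_factFormula (R : ℕ) (i j k : Fin numVars) :
    Holds G s a (factFormula R i j k) ↔ ∃ σ, FactLabel G s R σ ∧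
      varDen G s i (a (i + 3)) = componentDen G s 0 σ ∧
      varDen G s j (a (j + 3)) = componentDen G s 1 σ ∧
      varDen G s k (a (k + 3)) = componentDen G s 2 σ := by
  rw [factFormula, holds_strat_singleton (p := 2) (by norm_num)]
  · refine exists_congr fun σ => ?_
    simp only [holds_conj, holds_var_eq_component]
    rw [holds_box (φ := factLabelled R) trivial]
    simp [FactLabel]
  · exact ⟨trivial, trivial, trivial, trivial⟩

end Atoms

/-! ### Horn theories of partial recursive functions -/

open Nat.Partrec (Code)

/-- An atomic formula: a relation symbol, coded as a natural, applied to three variables. -/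
abbrev HornAtom : Type := ℕ × Fin numVars × Fin numVars × Fin numVars

/-- A Horn clause: a list of premises and a conclusion. -/
abbrev Clause : Type := List HornAtom × HornAtom

/-- An interpretation of the relation symbols over the natural numbers. -/
abbrev Interp : Type := ℕ → ℕ → ℕ → ℕ → Prop

def AtomTrue (I : Interp) (ρ : Fin numVars → ℕ) (A : HornAtom) : Prop :=
  I A.1 (ρ A.2.1) (ρ A.2.2.1) (ρ A.2.2.2)

def ClauseTrue (I : Interp) (C : Clause) : Prop :=
  ∀ ρ : Fin numVars → ℕ, (∀ A ∈ C.1, AtomTrue I ρ A) → AtomTrue I ρ C.2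

def zeroSym : ℕ := Nat.pair 0 0
def succSym : ℕ := Nat.pair 1 0
def addSym : ℕ := Nat.pair 2 0
def mulSym : ℕ := Nat.pair 3 0
def pairSym : ℕ := Nat.pair 4 0
def codeSym (c : Code) : ℕ := Nat.pair 5 (Encodable.encode c)
def numSym (k : ℕ) : ℕ := Nat.pair 6 k

def zeroAtom (i : Fin numVars) : HornAtom := (zeroSym, i, i, i)
def succAtom (i j : Fin numVars) : HornAtom := (succSym, i, j, j)
def addAtom (i j k : Fin numVars) : HornAtom := (addSym, i, j, k)
def mulAtom (i j k : Fin numVars) : HornAtom := (mulSym, i, j, k)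
def pairAtom (i j k : Fin numVars) : HornAtom := (pairSym, i, j, k)
def codeAtom (c : Code) (i j : Fin numVars) : HornAtom := (codeSym c, i, j, j)
def numAtom (k : ℕ) (i : Fin numVars) : HornAtom := (numSym k, i, i, i)

/-- The standard interpretation, by the tag and the index of a symbol. -/
def standardTag : ℕ → Interp
  | 0, _, x, _, _ => x = 0
  | 1, _, x, y, _ => y = x + 1
  | 2, _, x, y, z => z = x + y
  | 3, _, x, y, z => z = x * y
  | 4, _, x, y, z => z = Nat.pair x y
  | 5, i, x, y, _ => ∀ c : Code, Encodable.encode c = i → y ∈ c.eval x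
  | 6, k, x, _, _ => x = k
  | _, _, _, _, _ => False

/-- The standard interpretation of the relation symbols. -/
def standard : Interp := fun R => standardTag R.unpair.1 R.unpair.2

section Standard

variable {x y z : ℕ}

@[simp] theorem standard_zeroSym : standard zeroSym x y z ↔ x = 0 := by
  simp [standard, zeroSym, standardTag]
@[simp] theorem standard_succSym : standard succSym x y z ↔ y = x + 1 := by
  simp [standard, succSym, standardTag]
@[simp] theorem standard_addSym : standard addSym x y z ↔ z = x + y := by
  simp [standard, addSym, standardTag]
@[simp] theorem standard_mulSym : standard mulSym x y z ↔ z = x * y := by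
  simp [standard, mulSym, standardTag]
@[simp] theorem standard_pairSym : standard pairSym x y z ↔ z = Nat.pair x y := by
  simp [standard, pairSym, standardTag]
@[simp] theorem standard_codeSym {c : Code} :
    standard (codeSym c) x y z ↔ y ∈ c.eval x := by
  simp [standard, codeSym, standardTag]
@[simp] theorem standard_numSym {k : ℕ} : standard (numSym k) x y z ↔ x = k := by
  simp [standard, numSym, standardTag]

end Standard

/-- Clauses for addition, multiplication and the pairing function. -/
def arithClauses : List Clause :=
  [([zeroAtom 1], addAtom 0 1 0),
    ([addAtom 0 1 2, succAtom 1 3, succAtom 2 4], addAtom 0 3 4),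
    ([zeroAtom 1], mulAtom 0 1 1),
    ([mulAtom 0 1 2, succAtom 1 3, addAtom 2 0 4], mulAtom 0 3 4),
    ([succAtom 2 3, addAtom 0 3 1, mulAtom 1 1 4, addAtom 4 0 5], pairAtom 0 1 5),
    ([addAtom 1 2 0, mulAtom 0 0 3, addAtom 3 0 4, addAtom 4 1 5], pairAtom 0 1 5)]

/-- Clauses that define the graph of a partial recursive function. -/
def codeClauses : Code → List Clause
  | .zero => [([zeroAtom 1], codeAtom .zero 0 1)]
  | .succ => [([succAtom 0 1], codeAtom .succ 0 1)]
  | .left => [([pairAtom 0 1 2], codeAtom .left 2 0)]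
  | .right => [([pairAtom 0 1 2], codeAtom .right 2 1)]
  | .pair f g => codeClauses f ++ codeClauses g ++
      [([codeAtom f 0 1, codeAtom g 0 2, pairAtom 1 2 3], codeAtom (.pair f g) 0 3)]
  | .comp f g => codeClauses f ++ codeClauses g ++
      [([codeAtom g 0 1, codeAtom f 1 2], codeAtom (.comp f g) 0 2)]
  | .prec f g => codeClauses f ++ codeClauses g ++
      [([codeAtom f 0 1, zeroAtom 2, pairAtom 0 2 3], codeAtom (.prec f g) 3 1),
        ([pairAtom 0 1 2, codeAtom (.prec f g) 2 3, pairAtom 1 3 4, pairAtom 0 4 5,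
          codeAtom g 5 6, succAtom 1 7, pairAtom 0 7 8], codeAtom (.prec f g) 8 6)]
  | .rfind' f => codeClauses f ++
      [([pairAtom 0 1 2, zeroAtom 3, codeAtom f 2 3], codeAtom (.rfind' f) 2 1),
        ([pairAtom 0 1 2, succAtom 3 4, codeAtom f 2 4, succAtom 1 5, pairAtom 0 5 6,
          codeAtom (.rfind' f) 6 7], codeAtom (.rfind' f) 2 7)]

theorem mem_eval_pair {f g : Code} {x y : ℕ} :
    y ∈ (Code.pair f g).eval x ↔ ∃ a ∈ f.eval x, ∃ b ∈ g.eval x, y = Nat.pair a b := by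
  simp [Code.eval, Seq.seq, eq_comm]

theorem mem_eval_comp {f g : Code} {x y : ℕ} :
    y ∈ (Code.comp f g).eval x ↔ ∃ a ∈ g.eval x, y ∈ f.eval a :=
  Part.mem_bind_iff

theorem mem_eval_prec_succ {f g : Code} {a n y : ℕ} :
    y ∈ (Code.prec f g).eval (Nat.pair a (n + 1)) ↔
      ∃ i ∈ (Code.prec f g).eval (Nat.pair a n), y ∈ g.eval (Nat.pair a (Nat.pair n i)) := by
  rw [← Nat.succ_eq_add_one, Code.eval_prec_succ]
  simp

theorem mem_eval_rfind {f : Code} {a m y : ℕ} :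
    y ∈ (Code.rfind' f).eval (Nat.pair a m) ↔ ∃ k, y = k + m ∧
      0 ∈ f.eval (Nat.pair a (k + m)) ∧
      ∀ i < k, ∃ r, r + 1 ∈ f.eval (Nat.pair a (i + m)) := by
  simp only [Code.eval, Nat.unpaired, Nat.unpair_pair, Part.mem_map_iff, Part.map_eq_map]
  constructor
  · rintro ⟨k, hk, rfl⟩
    have hz := Nat.rfind_spec hk
    have h : ∀ {i}, i < k → _ := Nat.rfind_min hk
    simp only [Part.mem_map_iff, decide_eq_true_eq, decide_eq_false_iff_not] at hz h
    obtain ⟨z, hz, rfl⟩ := hz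
    refine ⟨k, rfl, hz, fun i hi => ?_⟩
    obtain ⟨z, hz, hz0⟩ := h hi
    exact ⟨z - 1, by rwa [Nat.sub_add_cancel (Nat.one_le_iff_ne_zero.2 hz0)]⟩
  · rintro ⟨k, rfl, h0, h⟩
    refine ⟨k, Nat.mem_rfind.2 ⟨?_, fun {i} hi => ?_⟩, rfl⟩
    · exact Part.mem_map_iff _ |>.2 ⟨0, h0, rfl⟩
    · obtain ⟨r, hr⟩ := h i hi
      exact Part.mem_map_iff _ |>.2 ⟨r + 1, hr, by simp⟩

theorem standard_arithClauses {C : Clause} (hC : C ∈ arithClauses) : ClauseTrue standard C := by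
  intro ρ h
  simp only [arithClauses, List.mem_cons, List.not_mem_nil, or_false] at hC
  rcases hC with rfl | rfl | rfl | rfl | rfl | rfl <;>
    simp [AtomTrue, zeroAtom, succAtom, addAtom, mulAtom, pairAtom] at h ⊢
  · simp [h]
  · omega
  · simp [h]
  · obtain ⟨h₁, h₂, h₃⟩ := h
    rw [h₃, h₂, h₁]
    ring
  · obtain ⟨h₁, h₂, h₃, h₄⟩ := h
    rw [Nat.pair, if_pos (by omega), h₄, h₃]
  · obtain ⟨h₁, h₂, h₃, h₄⟩ := h
    rw [Nat.pair, if_neg (by omega), h₄, h₃, h₂]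

theorem standard_codeClauses {c : Code} {C : Clause} (hC : C ∈ codeClauses c) :
    ClauseTrue standard C := by
  induction c with
  | zero =>
    simp only [codeClauses, List.mem_singleton] at hC
    subst hC
    intro ρ h
    simp [AtomTrue, zeroAtom, codeAtom, Code.eval] at h ⊢
    simp [h, pure, PFun.pure]
  | succ =>
    simp only [codeClauses, List.mem_singleton] at hC
    subst hC
    intro ρ h
    simp [AtomTrue, succAtom, codeAtom, Code.eval] at h ⊢
    simp [h]
  | left =>
    simp only [codeClauses, List.mem_singleton] at hC
    subst hC
    intro ρ h
    simp [AtomTrue, pairAtom, codeAtom, Code.eval] at h ⊢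
    simp [h]
  | right =>
    simp only [codeClauses, List.mem_singleton] at hC
    subst hC
    intro ρ h
    simp [AtomTrue, pairAtom, codeAtom, Code.eval] at h ⊢
    simp [h]
  | pair f g ihf ihg =>
    simp only [codeClauses, List.mem_append, List.mem_singleton] at hC
    rcases hC with (hC | hC) | rfl
    · exact ihf hC
    · exact ihg hC
    · intro ρ h
      simp [AtomTrue, pairAtom, codeAtom] at h ⊢
      exact mem_eval_pair.2 ⟨_, h.1, _, h.2.1, h.2.2⟩
  | comp f g ihf ihg =>
    simp only [codeClauses, List.mem_append, List.mem_singleton] at hC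
    rcases hC with (hC | hC) | rfl
    · exact ihf hC
    · exact ihg hC
    · intro ρ h
      simp [AtomTrue, codeAtom] at h ⊢
      exact mem_eval_comp.2 ⟨_, h.1, h.2⟩
  | prec f g ihf ihg =>
    simp only [codeClauses, List.mem_append, List.mem_cons, List.not_mem_nil, or_false] at hC
    rcases hC with (hC | hC) | rfl | rfl
    · exact ihf hC
    · exact ihg hC
    · intro ρ h
      simp [AtomTrue, pairAtom, codeAtom, zeroAtom] at h ⊢
      obtain ⟨h₁, h₂, h₃⟩ := h
      rwa [h₃, h₂, Code.eval_prec_zero]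
    · intro ρ h
      simp [AtomTrue, pairAtom, codeAtom, succAtom] at h ⊢
      obtain ⟨h₁, h₂, h₃, h₄, h₅, h₆, h₇⟩ := h
      rw [h₇, h₆]
      exact mem_eval_prec_succ.2 ⟨_, h₁ ▸ h₂, by rwa [← h₃, ← h₄]⟩
  | rfind' f ihf =>
    simp only [codeClauses, List.mem_append, List.mem_cons, List.not_mem_nil, or_false] at hC
    rcases hC with hC | rfl | rfl
    · exact ihf hC
    · intro ρ h
      simp [AtomTrue, pairAtom, codeAtom, zeroAtom] at h ⊢
      obtain ⟨h₁, h₂, h₃⟩ := h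
      rw [h₁, mem_eval_rfind]
      exact ⟨0, by simp, by rwa [zero_add, ← h₁, ← h₂], by simp⟩
    · intro ρ h
      simp [AtomTrue, pairAtom, codeAtom, succAtom] at h ⊢
      obtain ⟨h₁, h₂, h₃, h₄, h₅, h₆⟩ := h
      rw [h₅, h₄, mem_eval_rfind] at h₆
      obtain ⟨k, hk, h0, hlt⟩ := h₆
      rw [h₁, mem_eval_rfind]
      refine ⟨k + 1, by omega, by rwa [add_right_comm, add_assoc], fun i hi => ?_⟩
      rcases i with _ | i
      · exact ⟨_, by rw [zero_add, ← h₁, ← h₂]; exact h₃⟩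
      · obtain ⟨r, hr⟩ := hlt i (by omega)
        exact ⟨r, by rwa [add_right_comm, add_assoc]⟩

section Derivation

variable {I : Interp}

theorem add_derivable (h0 : I zeroSym 0 0 0) (hS : ∀ n, I succSym n (n + 1) (n + 1))
    (hI : ∀ C ∈ arithClauses, ClauseTrue I C) (x y : ℕ) : I addSym x y (x + y) := by
  induction y with
  | zero =>
    simpa [AtomTrue, zeroAtom, addAtom, h0] using
      hI ([zeroAtom 1], addAtom 0 1 0) (by simp [arithClauses]) ![x, 0, 0, 0, 0, 0, 0, 0, 0, 0]
  | succ y ih =>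
    simpa [AtomTrue, succAtom, addAtom, ih, hS, ← add_assoc] using
      hI ([addAtom 0 1 2, succAtom 1 3, succAtom 2 4], addAtom 0 3 4) (by simp [arithClauses])
        ![x, y, x + y, y + 1, x + y + 1, 0, 0, 0, 0, 0]

theorem mul_derivable (h0 : I zeroSym 0 0 0) (hS : ∀ n, I succSym n (n + 1) (n + 1))
    (hI : ∀ C ∈ arithClauses, ClauseTrue I C) (x y : ℕ) : I mulSym x y (x * y) := by
  have hadd := add_derivable h0 hS hI
  induction y with
  | zero =>
    simpa [AtomTrue, zeroAtom, mulAtom, h0] using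
      hI ([zeroAtom 1], mulAtom 0 1 1) (by simp [arithClauses]) ![x, 0, 0, 0, 0, 0, 0, 0, 0, 0]
  | succ y ih =>
    simpa [AtomTrue, succAtom, addAtom, mulAtom, ih, hS, hadd, mul_add] using
      hI ([mulAtom 0 1 2, succAtom 1 3, addAtom 2 0 4], mulAtom 0 3 4) (by simp [arithClauses])
        ![x, y, x * y, y + 1, x * y + x, 0, 0, 0, 0, 0]

theorem pair_derivable (h0 : I zeroSym 0 0 0) (hS : ∀ n, I succSym n (n + 1) (n + 1))
    (hI : ∀ C ∈ arithClauses, ClauseTrue I C) (x y : ℕ) : I pairSym x y (Nat.pair x y) := by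
  have hadd := add_derivable h0 hS hI
  have hmul := mul_derivable h0 hS hI
  rw [Nat.pair]
  split_ifs with hxy
  · obtain ⟨k, rfl⟩ := Nat.exists_eq_add_of_lt hxy
    rw [add_assoc]
    simpa [AtomTrue, succAtom, addAtom, mulAtom, pairAtom, hS, hadd, hmul] using
      hI ([succAtom 2 3, addAtom 0 3 1, mulAtom 1 1 4, addAtom 4 0 5], pairAtom 0 1 5)
        (by simp [arithClauses])
        ![x, x + (k + 1), k, k + 1, (x + (k + 1)) * (x + (k + 1)),
          (x + (k + 1)) * (x + (k + 1)) + x, 0, 0, 0, 0]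
  · obtain ⟨k, rfl⟩ := Nat.exists_eq_add_of_le (not_lt.1 hxy)
    simpa [AtomTrue, addAtom, mulAtom, pairAtom, hadd, hmul] using
      hI ([addAtom 1 2 0, mulAtom 0 0 3, addAtom 3 0 4, addAtom 4 1 5], pairAtom 0 1 5)
        (by simp [arithClauses])
        ![y + k, y, k, (y + k) * (y + k), (y + k) * (y + k) + (y + k),
          (y + k) * (y + k) + (y + k) + y, 0, 0, 0, 0]

theorem code_derivable (h0 : I zeroSym 0 0 0) (hS : ∀ n, I succSym n (n + 1) (n + 1))
    (hI : ∀ C ∈ arithClauses, ClauseTrue I C) {c : Code}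
    (hc : ∀ C ∈ codeClauses c, ClauseTrue I C) {x y : ℕ} (hy : y ∈ c.eval x) :
    I (codeSym c) x y y := by
  have hpair := pair_derivable h0 hS hI
  induction c generalizing x y with
  | zero =>
    obtain rfl : y = 0 := by simpa [Code.eval, pure, PFun.pure] using hy
    simpa [AtomTrue, zeroAtom, codeAtom, h0] using
      hc ([zeroAtom 1], codeAtom .zero 0 1) (by simp [codeClauses])
        ![x, 0, 0, 0, 0, 0, 0, 0, 0, 0]
  | succ =>
    obtain rfl : y = x + 1 := by simpa [Code.eval] using hy
    simpa [AtomTrue, succAtom, codeAtom, hS] using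
      hc ([succAtom 0 1], codeAtom .succ 0 1) (by simp [codeClauses])
        ![x, x + 1, 0, 0, 0, 0, 0, 0, 0, 0]
  | left =>
    obtain rfl : y = x.unpair.1 := by simpa [Code.eval] using hy
    have := hpair x.unpair.1 x.unpair.2
    rw [Nat.pair_unpair] at this
    simpa [AtomTrue, pairAtom, codeAtom, this] using
      hc ([pairAtom 0 1 2], codeAtom .left 2 0) (by simp [codeClauses])
        ![x.unpair.1, x.unpair.2, x, 0, 0, 0, 0, 0, 0, 0]
  | right =>
    obtain rfl : y = x.unpair.2 := by simpa [Code.eval] using hy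
    have := hpair x.unpair.1 x.unpair.2
    rw [Nat.pair_unpair] at this
    simpa [AtomTrue, pairAtom, codeAtom, this] using
      hc ([pairAtom 0 1 2], codeAtom .right 2 1) (by simp [codeClauses])
        ![x.unpair.1, x.unpair.2, x, 0, 0, 0, 0, 0, 0, 0]
  | pair f g ihf ihg =>
    obtain ⟨a, ha, b, hb, rfl⟩ := mem_eval_pair.1 hy
    have h₁ := ihf (fun C hC => hc C (by simp [codeClauses, hC])) ha
    have h₂ := ihg (fun C hC => hc C (by simp [codeClauses, hC])) hb
    simpa [AtomTrue, pairAtom, codeAtom, h₁, h₂, hpair] using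
      hc ([codeAtom f 0 1, codeAtom g 0 2, pairAtom 1 2 3], codeAtom (.pair f g) 0 3)
        (by simp [codeClauses]) ![x, a, b, Nat.pair a b, 0, 0, 0, 0, 0, 0]
  | comp f g ihf ihg =>
    obtain ⟨a, ha, hb⟩ := mem_eval_comp.1 hy
    have h₁ := ihg (fun C hC => hc C (by simp [codeClauses, hC])) ha
    have h₂ := ihf (fun C hC => hc C (by simp [codeClauses, hC])) hb
    simpa [AtomTrue, codeAtom, h₁, h₂] using
      hc ([codeAtom g 0 1, codeAtom f 1 2], codeAtom (.comp f g) 0 2)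
        (by simp [codeClauses]) ![x, a, y, 0, 0, 0, 0, 0, 0, 0]
  | prec f g ihf ihg =>
    replace ihf := @ihf (fun C hC => hc C (by simp [codeClauses, hC]))
    replace ihg := @ihg (fun C hC => hc C (by simp [codeClauses, hC]))
    obtain ⟨a, n, rfl⟩ : ∃ a n, x = Nat.pair a n := ⟨_, _, (Nat.pair_unpair x).symm⟩
    induction n generalizing y with
    | zero =>
      rw [Code.eval_prec_zero] at hy
      simpa [AtomTrue, codeAtom, zeroAtom, pairAtom, ihf hy, h0, hpair] using
        hc ([codeAtom f 0 1, zeroAtom 2, pairAtom 0 2 3], codeAtom (.prec f g) 3 1)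
          (by simp [codeClauses]) ![a, y, 0, Nat.pair a 0, 0, 0, 0, 0, 0, 0]
    | succ n ih =>
      obtain ⟨i, hi, hy⟩ := mem_eval_prec_succ.1 hy
      simpa [AtomTrue, codeAtom, succAtom, pairAtom, ih hi, ihg hy, hS, hpair] using
        hc ([pairAtom 0 1 2, codeAtom (.prec f g) 2 3, pairAtom 1 3 4, pairAtom 0 4 5,
          codeAtom g 5 6, succAtom 1 7, pairAtom 0 7 8], codeAtom (.prec f g) 8 6)
          (by simp [codeClauses])
          ![a, n, Nat.pair a n, i, Nat.pair n i, Nat.pair a (Nat.pair n i), y, n + 1,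
            Nat.pair a (n + 1), 0]
  | rfind' f ihf =>
    replace ihf := @ihf (fun C hC => hc C (by simp [codeClauses, hC]))
    obtain ⟨a, m, rfl⟩ : ∃ a m, x = Nat.pair a m := ⟨_, _, (Nat.pair_unpair x).symm⟩
    obtain ⟨k, rfl, hk, hlt⟩ := mem_eval_rfind.1 hy
    clear hy
    induction k generalizing m with
    | zero =>
      rw [zero_add] at hk ⊢
      simpa [AtomTrue, codeAtom, zeroAtom, pairAtom, ihf hk, h0, hpair] using
        hc ([pairAtom 0 1 2, zeroAtom 3, codeAtom f 2 3], codeAtom (.rfind' f) 2 1)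
          (by simp [codeClauses]) ![a, m, Nat.pair a m, 0, 0, 0, 0, 0, 0, 0]
    | succ k ih =>
      have shift : ∀ i, i + 1 + m = i + (m + 1) := fun i => by omega
      obtain ⟨r, hr⟩ := hlt 0 (by omega)
      rw [zero_add] at hr
      rw [shift] at hk ⊢
      have h₁ := ih (m + 1) hk fun i hi => by
        rw [← shift]
        exact hlt (i + 1) (by omega)
      simpa [AtomTrue, codeAtom, succAtom, pairAtom, ihf hr, h₁, hS, hpair] using
        hc ([pairAtom 0 1 2, succAtom 3 4, codeAtom f 2 4, succAtom 1 5, pairAtom 0 5 6,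
          codeAtom (.rfind' f) 6 7], codeAtom (.rfind' f) 2 7)
          (by simp [codeClauses])
          ![a, m, Nat.pair a m, r, r + 1, m + 1, Nat.pair a (m + 1), k + (m + 1), 0, 0]

end Derivation

/-! ### The formula expressing divergence -/

/-- The formula stating a Horn atom about the elements denoted by the variables. -/
def atomFormula (A : HornAtom) : Formula := factFormula A.1 A.2.1 A.2.2.1 A.2.2.2

/-- Conjunction of a list of formulas. -/
def conjList : List Formula → Formula
  | [] => .neg (.conj (.atom 0) (.neg (.atom 0)))
  | φ :: l => .conj φ (conjList l)

/-- The formula stating a Horn clause. -/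
def clauseFormula (C : Clause) : Formula :=
  .neg (.conj (conjList (C.1.map atomFormula)) (.neg (atomFormula C.2)))

/-- Some element is zero. -/
def existsZero : Formula := .strat [3] (atomFormula (zeroAtom 0))

/-- The element denoted by variable `0` has a successor, which variable `0` can denote as well. -/
def existsSucc : Formula :=
  .strat [4] (.conj (atomFormula (succAtom 0 1)) (.strat [3] (sameMarks (varTerm 0) (varTerm 1))))

/-- Variable `j` can denote the element denoted by variable `0`. -/
def existsCopy (j : Fin numVars) : Formula := .strat [j + 3] (sameMarks (varTerm 0) (varTerm j))

/-- The part of the theory that does not depend on the input. -/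
def theoryFormula (c : Code) : Formula :=
  conjList (existsZero :: existsSucc :: (List.ofFn existsCopy ++
    (arithClauses ++ codeClauses c).map clauseFormula))

/-- Clauses deriving that an element is the numeral `n`. -/
def numeralFormula : ℕ → Formula
  | 0 => clauseFormula ([zeroAtom 0], numAtom 0 0)
  | k + 1 => .conj (numeralFormula k)
      (clauseFormula ([numAtom k 0, succAtom 0 1], numAtom (k + 1) 1))

/-- The code `c` has no value at `n`. -/
def noValueFormula (c : Code) (n : ℕ) : Formula :=
  .neg (.conj (atomFormula (numAtom n 0)) (atomFormula (codeAtom c 0 1)))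

def divergenceMatrix (c : Code) (n : ℕ) : Formula :=
  .conj (theoryFormula c) (.conj (numeralFormula n) (noValueFormula c n))

/-- A formula that is satisfiable if and only if the code `c` diverges at `n`. -/
def divergenceFormula (c : Code) (n : ℕ) : Formula := always (divergenceMatrix c n)

theorem isStateFormula_conjList {l : List Formula} (h : ∀ φ ∈ l, IsStateFormula φ) :
    IsStateFormula (conjList l) := by
  induction l with
  | nil => exact ⟨trivial, trivial⟩
  | cons φ l ih => exact ⟨h φ (by simp), ih fun ψ hψ => h ψ (by simp [hψ])⟩

theorem isStateFormula_clauseFormula (C : Clause) : IsStateFormula (clauseFormula C) := by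
  refine ⟨isStateFormula_conjList fun φ hφ => ?_, trivial⟩
  obtain ⟨A, -, rfl⟩ := List.mem_map.1 hφ
  trivial

theorem isStateFormula_divergenceMatrix (c : Code) (n : ℕ) :
    IsStateFormula (divergenceMatrix c n) := by
  refine ⟨isStateFormula_conjList fun φ hφ => ?_, ?_, trivial, trivial⟩
  · simp only [List.mem_cons, List.mem_append, List.mem_ofFn, List.mem_map] at hφ
    rcases hφ with rfl | rfl | ⟨j, rfl⟩ | ⟨C, -, rfl⟩
    · trivial
    · trivial
    · trivial
    · exact isStateFormula_clauseFormula C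
  · induction n with
    | zero => exact isStateFormula_clauseFormula _
    | succ k ih => exact ⟨ih, isStateFormula_clauseFormula _⟩

section Semantics

variable {G : CGS} {s : G.State} {a : ℕ → Strategy G}

theorem holds_conjList {l : List Formula} :
    Holds G s a (conjList l) ↔ ∀ φ ∈ l, Holds G s a φ := by
  induction l with
  | nil => simp [conjList]
  | cons φ l ih => simp [conjList, ih]

theorem holds_clauseFormula {C : Clause} : Holds G s a (clauseFormula C) ↔
    ((∀ A ∈ C.1, Holds G s a (atomFormula A)) → Holds G s a (atomFormula C.2)) := by
  simp only [clauseFormula, holds_neg, holds_conj, holds_conjList, List.forall_mem_map, not_and,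
    not_not]

theorem holds_theoryFormula {c : Code} : Holds G s a (theoryFormula c) ↔
    Holds G s a existsZero ∧ Holds G s a existsSucc ∧ (∀ j, Holds G s a (existsCopy j)) ∧
      (∀ C ∈ arithClauses, Holds G s a (clauseFormula C)) ∧
      ∀ C ∈ codeClauses c, Holds G s a (clauseFormula C) := by
  simp only [theoryFormula, holds_conjList, List.forall_mem_cons, List.forall_mem_append,
    List.map_append, List.forall_mem_map, List.mem_ofFn, forall_exists_index,
    forall_apply_eq_imp_iff]

theorem holds_existsCopy (j : Fin numVars) :
    Holds G s a (existsCopy j) ↔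
      ∃ σ, Holds G s (Function.update a (j + 3) σ) (sameMarks (varTerm 0) (varTerm j)) :=
  holds_strat_singleton (Nat.add_lt_add_right j.isLt 3) trivial

theorem holds_existsZero :
    Holds G s a existsZero ↔
      ∃ σ, Holds G s (Function.update a 3 σ) (atomFormula (zeroAtom 0)) :=
  holds_strat_singleton (by norm_num) trivial

theorem holds_existsSucc :
    Holds G s a existsSucc ↔
      ∃ σ, Holds G s (Function.update a 4 σ) (atomFormula (succAtom 0 1)) ∧
        ∃ τ, Holds G s (Function.update (Function.update a 4 σ) 3 τ)
          (sameMarks (varTerm 0) (varTerm 1)) := by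
  rw [existsSucc, holds_strat_singleton (by norm_num)]
  · refine exists_congr fun σ => ?_
    rw [holds_conj, holds_strat_singleton (p := 3) (by norm_num)]
    trivial
  · exact ⟨trivial, trivial⟩

/-- A fact labelled `R` has the components `d₀`, `d₁`, `d₂`. -/
def FactAt (G : CGS) (s : G.State) (R : ℕ) (d₀ d₁ d₂ : Set (Strategy G)) : Prop :=
  ∃ σ, FactLabel G s R σ ∧ d₀ = componentDen G s 0 σ ∧ d₁ = componentDen G s 1 σ ∧
    d₂ = componentDen G s 2 σ

theorem holds_atomFormula {A : HornAtom} : Holds G s a (atomFormula A) ↔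
    FactAt G s A.1 (varDen G s A.2.1 (a (A.2.1 + 3))) (varDen G s A.2.2.1 (a (A.2.2.1 + 3)))
      (varDen G s A.2.2.2 (a (A.2.2.2 + 3))) :=
  holds_factFormula _ _ _ _

/-- Strategies of variable `0` that denote the natural numbers. -/
theorem exists_numerals {c : Code} (h : ∀ a, Holds G s a (theoryFormula c)) :
    ∃ t : ℕ → Strategy G,
      FactAt G s zeroSym (varDen G s 0 (t 0)) (varDen G s 0 (t 0)) (varDen G s 0 (t 0)) ∧
      ∀ n, FactAt G s succSym (varDen G s 0 (t n)) (varDen G s 0 (t (n + 1)))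
        (varDen G s 0 (t (n + 1))) := by
  obtain ⟨m⟩ := G.move_nonempty
  obtain ⟨z, hz⟩ := holds_existsZero.1 (holds_theoryFormula.1 (h fun _ _ => m)).1
  have hs : ∀ τ, ∃ τ', FactAt G s succSym (varDen G s 0 τ) (varDen G s 0 τ')
      (varDen G s 0 τ') := by
    intro τ
    obtain ⟨σ, h₁, τ', h₂⟩ := holds_existsSucc.1 (holds_theoryFormula.1 (h fun _ => τ)).2.1
    refine ⟨τ', ?_⟩
    rw [holds_var_eq_var] at h₂
    rw [holds_atomFormula] at h₁
    simp [succAtom] at h₁ h₂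
    rwa [h₂]
  choose next hnext using hs
  refine ⟨fun n => next^[n] z, ?_, fun n => ?_⟩
  · rw [holds_atomFormula] at hz
    simpa [zeroAtom] using hz
  · simp only [Function.iterate_succ_apply']
    exact hnext _

/-- The interpretation over the natural numbers induced by a choice of numerals. -/
def inducedInterp (G : CGS) (s : G.State) (t : ℕ → Strategy G) : Interp :=
  fun R x y z => FactAt G s R (varDen G s 0 (t x)) (varDen G s 0 (t y)) (varDen G s 0 (t z))

theorem exists_assignment {c : Code} (h : ∀ a, Holds G s a (theoryFormula c))
    (t : ℕ → Strategy G) (ρ : Fin numVars → ℕ) :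
    ∃ a : ℕ → Strategy G, ∀ A : HornAtom,
      Holds G s a (atomFormula A) ↔ AtomTrue (inducedInterp G s t) ρ A := by
  have hcopy : ∀ j, ∃ σ, varDen G s j σ = varDen G s 0 (t (ρ j)) := by
    intro j
    by_cases hj : j = 0
    · exact ⟨t (ρ j), by rw [hj]⟩
    · obtain ⟨σ, hσ⟩ := (holds_existsCopy j).1
        ((holds_theoryFormula.1 (h fun _ => t (ρ j))).2.2.1 j)
      rw [holds_var_eq_var] at hσ
      have hj' : (0 : ℕ) ≠ j := fun e => hj (Fin.ext e.symm)
      exact ⟨σ, by simpa [Function.update_apply, hj, hj'] using hσ.symm⟩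
  choose σ hσ using hcopy
  refine ⟨fun p => if hp : p - 3 < numVars then σ ⟨p - 3, hp⟩ else t 0, fun A => ?_⟩
  rw [holds_atomFormula]
  simp [AtomTrue, inducedInterp, hσ]

theorem clauseTrue_inducedInterp {c : Code} (h : ∀ a, Holds G s a (theoryFormula c))
    (t : ℕ → Strategy G) {C : Clause} (hC : ∀ a, Holds G s a (clauseFormula C)) :
    ClauseTrue (inducedInterp G s t) C := by
  intro ρ hρ
  obtain ⟨a, ha⟩ := exists_assignment h t ρ
  exact (ha _).1 (holds_clauseFormula.1 (hC a) fun A hA => (ha A).2 (hρ A hA))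

theorem not_dom_of_holds {c : Code} {n : ℕ} (h : ∀ a, Holds G s a (divergenceMatrix c n)) :
    ¬ (c.eval n).Dom := by
  intro hdom
  obtain ⟨y, hy⟩ := Part.dom_iff_mem.1 hdom
  have hth : ∀ a, Holds G s a (theoryFormula c) := fun a => (h a).1
  obtain ⟨t, h0, hS⟩ := exists_numerals hth
  have hcode : inducedInterp G s t (codeSym c) n y y :=
    code_derivable (I := inducedInterp G s t) h0 hS
      (fun C hC => clauseTrue_inducedInterp hth t fun a =>
        (holds_theoryFormula.1 (hth a)).2.2.2.1 C hC)
      (fun C hC => clauseTrue_inducedInterp hth t fun a =>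
        (holds_theoryFormula.1 (hth a)).2.2.2.2 C hC) hy
  have hnum : ∀ k, (∀ a, Holds G s a (numeralFormula k)) →
      inducedInterp G s t (numSym k) k k k := by
    intro k
    induction k with
    | zero =>
      intro hk
      refine clauseTrue_inducedInterp hth t hk (fun _ => 0) fun A hA => ?_
      obtain rfl := List.mem_singleton.1 hA
      exact h0
    | succ k ih =>
      intro hk
      have h₁ := ih fun a => (hk a).1
      have h₂ : inducedInterp G s t succSym k (k + 1) (k + 1) := hS k
      simpa [AtomTrue, numAtom, succAtom, h₁, h₂] using
        clauseTrue_inducedInterp hth t (fun a => (hk a).2)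
          ![k, k + 1, 0, 0, 0, 0, 0, 0, 0, 0]
  obtain ⟨a, ha⟩ := exists_assignment hth t ![n, y, 0, 0, 0, 0, 0, 0, 0, 0]
  refine (h a).2.2 ⟨(ha _).2 ?_, (ha _).2 ?_⟩
  · exact hnum n fun a => (h a).2.1
  · exact hcode

end Semantics

/-! ### The standard game -/

/-- States of the standard game. -/
inductive GameState : Type
  | root : GameState
  | hub : ℕ → GameState
  | fact : ℕ × (ℕ → ℕ) → GameState
  | component : ℕ → ℕ → GameState
  | element : ℕ → GameState
  | result : ℕ → GameState

/-- The labels of the states of the standard game. -/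
def gameLabel : GameState → ℕ → Prop
  | .root, _ => False
  | .hub p, q => q = p
  | .fact m, R => R = m.1 ∧ standard R (m.2 0) (m.2 1) (m.2 2)
  | .component i _, q => q = i
  | .element _, _ => False
  | .result b, _ => b = 0

/-- The transition function of the standard game. -/
def gameTrans : GameState → (ℕ → ℕ × (ℕ → ℕ)) → GameState
  | .root, mv => .hub ((mv 0).2 0)
  | .hub p, mv => if p = 2 then .fact (mv 2) else .element ((mv (p % numPlayers)).2 0)
  | .fact m, mv => .component ((mv 0).2 0) (m.2 ((mv 0).2 0))
  | .component _ n, _ => .element n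
  | .element _, mv => .result ((mv 1).2 0)
  | .result b, _ => .result b

/-- The game in which the selector chooses a hub, each variable chooses a number at its hub,
player `2` chooses a fact at its hub, and the marker marks numbers. -/
abbrev standardGame : CGS where
  State := GameState
  Move := ℕ × (ℕ → ℕ)
  move_nonempty := ⟨(0, fun _ => 0)⟩
  label := gameLabel
  trans := gameTrans

theorem turnBased_standardGame : TurnBased standardGame := by
  intro s
  cases s with
  | hub p =>
    by_cases hp : p = 2
    · exact ⟨2, fun mv mv' h => by simp [gameTrans, hp, h]⟩
    · exact ⟨p % numPlayers, fun mv mv' h => by simp only [gameTrans, if_neg hp, h]⟩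
  | element n => exact ⟨1, fun mv mv' h => by simp [gameTrans, h]⟩
  | root => exact ⟨0, fun mv mv' h => by simp [gameTrans, h]⟩
  | fact m => exact ⟨0, fun mv mv' h => by simp [gameTrans, h]⟩
  | component i n => exact ⟨0, fun mv mv' h => rfl⟩
  | result b => exact ⟨0, fun mv mv' h => rfl⟩

namespace StandardGame

/-- The successor of a state when all players follow their strategy. -/
def step (a : ℕ → Strategy standardGame) (s : GameState) : GameState :=
  gameTrans s fun p => a p s

theorem trans_eq_step {a : ℕ → Strategy standardGame} {s : GameState}
    {mv : ℕ → ℕ × (ℕ → ℕ)} (h : ∀ p < numPlayers, mv p = a p s) :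
    gameTrans s mv = step a s := by
  cases s with
  | root => simp [gameTrans, step, h]
  | hub p => simp [gameTrans, step, h, Nat.mod_lt]
  | fact m => simp [gameTrans, step, h]
  | component i n => rfl
  | element n => simp [gameTrans, step, h]
  | result b => rfl

theorem isOutcome_iff {a : ℕ → Strategy standardGame} {s : GameState} {π : ℕ → GameState} :
    IsOutcome standardGame (fullCtx standardGame a) s π ↔ π = fun n => (step a)^[n] s := by
  constructor
  · rintro ⟨h0, h⟩
    funext n
    induction n with
    | zero => exact h0
    | succ n ih =>
      obtain ⟨mv, hmv, hn⟩ := h n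
      rw [Function.iterate_succ_apply', ← ih, hn]
      exact trans_eq_step fun p hp => hmv p (a p) (by simp [fullCtx, hp])
  · rintro rfl
    refine ⟨rfl, fun i => ⟨fun p => a p ((step a)^[i] s), fun p σ hσ => ?_,
      Function.iterate_succ_apply' _ _ _⟩⟩
    by_cases hp : p < numPlayers
    · obtain rfl : a p = σ := by simpa [fullCtx, hp] using hσ
      rfl
    · simp [fullCtx, hp] at hσ

theorem holds_select {a : ℕ → Strategy standardGame} {s : GameState} {φ : Formula} :
    Holds standardGame s a (.strat [0] φ) ↔ ∃ σ : Strategy standardGame,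
      sat standardGame φ (fullCtx standardGame (Function.update a 0 σ))
        fun n => (step (Function.update a 0 σ))^[n] s := by
  simp only [Holds, sat]
  constructor
  · rintro ⟨ctx', h₁, h₂, h₃⟩
    obtain ⟨σ, hσ⟩ := h₂ 0 (by simp)
    have key : ctx' = fullCtx standardGame (Function.update a 0 σ) := by
      funext p
      by_cases hp : p = 0
      · subst hp; simp [fullCtx, hσ]
      · rw [h₁ p (by simpa using hp)]; simp [fullCtx, hp]
    subst key
    exact ⟨σ, h₃ _ (isOutcome_iff.2 rfl)⟩
  · rintro ⟨σ, h⟩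
    refine ⟨fullCtx standardGame (Function.update a 0 σ), fun p hp => ?_, fun p hp => ?_,
      fun π hπ => ?_⟩
    · have : p ≠ 0 := by simpa using hp
      simp [fullCtx, this]
    · obtain rfl : p = 0 := by simpa using hp
      exact ⟨σ, by simp [fullCtx]⟩
    · rw [isOutcome_iff.1 hπ]
      exact h

/-- The number that variable `j` denotes under the strategy `σ`. -/
def value (j : Fin numVars) (σ : Strategy standardGame) : ℕ := (σ (.hub (j + 3))).2 0

/-- The number `n` is marked by the strategy `τ`. -/
def Marks (τ : Strategy standardGame) (n : ℕ) : Prop := (τ (.element n)).2 0 = 0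

theorem holds_varMarked {a : ℕ → Strategy standardGame} {j : Fin numVars} :
    Holds standardGame .root a (varMarked j) ↔ Marks (a 1) (value j (a (j + 3))) := by
  have hmod : ((j : ℕ) + 3) % numPlayers = j + 3 :=
    Nat.mod_eq_of_lt (Nat.add_lt_add_right j.isLt 3)
  rw [varMarked, holds_select]
  simp only [sat, Function.iterate_succ_apply', Function.iterate_zero_apply, zero_add]
  constructor
  · rintro ⟨σ, h₁, h₂⟩
    simp [step, gameTrans, gameLabel] at h₁ h₂
    rw [← h₁] at h₂
    simpa [hmod, Marks, value] using h₂
  · intro h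
    refine ⟨fun _ => (0, fun _ => j + 3), ?_⟩
    simpa [step, gameTrans, gameLabel, hmod, Marks, value] using h

theorem holds_componentMarked {a : ℕ → Strategy standardGame} {i : ℕ} :
    Holds standardGame .root a (componentMarked i) ↔ Marks (a 1) ((a 2 (.hub 2)).2 i) := by
  rw [componentMarked, holds_select]
  simp only [sat, Function.iterate_succ_apply', Function.iterate_zero_apply, zero_add]
  constructor
  · rintro ⟨σ, h₁, h₂, h₃⟩
    simp [step, gameTrans, gameLabel] at h₁ h₂ h₃
    simp [← h₁] at h₂ h₃
    rw [← h₂] at h₃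
    exact h₃
  · intro h
    refine ⟨fun s => (0, fun _ => match s with | .root => 2 | _ => i), ?_⟩
    simpa [step, gameTrans, gameLabel, Marks] using h

theorem holds_factLabelled {a : ℕ → Strategy standardGame} {R : ℕ} :
    Holds standardGame .root a (factLabelled R) ↔
      R = (a 2 (.hub 2)).1 ∧ standard R ((a 2 (.hub 2)).2 0) ((a 2 (.hub 2)).2 1)
        ((a 2 (.hub 2)).2 2) := by
  rw [factLabelled, holds_select]
  simp only [sat, Function.iterate_succ_apply', Function.iterate_zero_apply, zero_add]
  constructor
  · rintro ⟨σ, h₁, h₂⟩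
    simp [step, gameTrans, gameLabel] at h₁ h₂
    simpa [← h₁] using h₂
  · intro h
    refine ⟨fun _ => (0, fun _ => 2), ?_⟩
    simpa [step, gameTrans, gameLabel] using h

theorem varDen_eq (j : Fin numVars) (σ : Strategy standardGame) :
    varDen standardGame .root j σ = {τ | Marks τ (value j σ)} := by
  ext τ
  simp only [varDen, holds_varMarked, Set.mem_ofPred_eq]
  constructor
  · intro h
    have h₁ := h (fun p => if p = 1 then τ else σ) (by simp) (by simp)
    simpa using h₁
  · rintro h a rfl rfl
    exact h

theorem componentDen_eq (i : ℕ) (σ : Strategy standardGame) :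
    componentDen standardGame .root i σ = {τ | Marks τ ((σ (.hub 2)).2 i)} := by
  ext τ
  simp only [componentDen, holds_componentMarked, Set.mem_ofPred_eq]
  constructor
  · intro h
    have h₁ := h (fun p => if p = 1 then τ else σ) (by simp) (by simp)
    simpa using h₁
  · rintro h a rfl rfl
    exact h

theorem factLabel_iff {R : ℕ} {σ : Strategy standardGame} :
    FactLabel standardGame .root R σ ↔
      R = (σ (.hub 2)).1 ∧ standard R ((σ (.hub 2)).2 0) ((σ (.hub 2)).2 1)
        ((σ (.hub 2)).2 2) := by
  simp only [FactLabel, holds_factLabelled]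
  constructor
  · intro h
    exact h (fun _ => σ) rfl
  · rintro h a rfl
    exact h

theorem setOf_marks_inj {m n : ℕ} : {τ | Marks τ m} = {τ | Marks τ n} ↔ m = n := by
  refine ⟨fun h => ?_, fun h => by rw [h]⟩
  let τ : Strategy standardGame := fun s =>
    (0, fun _ => match s with | .element k => k - m + (m - k) | _ => 0)
  have hm : Marks τ m := by simp [Marks, τ]
  have hn : Marks τ n := (Set.ext_iff.1 h τ).1 hm
  simp [Marks, τ] at hn
  omega

theorem holds_atomFormula_iff {a : ℕ → Strategy standardGame} {A : HornAtom} :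
    Holds standardGame .root a (atomFormula A) ↔
      AtomTrue standard (fun j => value j (a (j + 3))) A := by
  rw [holds_atomFormula]
  simp only [FactAt, factLabel_iff, varDen_eq, componentDen_eq, setOf_marks_inj, AtomTrue]
  constructor
  · rintro ⟨σ, ⟨-, h⟩, h₀, h₁, h₂⟩
    rwa [h₀, h₁, h₂]
  · intro h
    exact ⟨fun _ => (A.1, fun i => if i = 0 then value A.2.1 (a (A.2.1 + 3))
      else if i = 1 then value A.2.2.1 (a (A.2.2.1 + 3)) else value A.2.2.2 (a (A.2.2.2 + 3))),
      by simpa using h⟩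

theorem holds_clauseFormula_of_standard {a : ℕ → Strategy standardGame} {C : Clause}
    (hC : ClauseTrue standard C) : Holds standardGame .root a (clauseFormula C) := by
  rw [holds_clauseFormula]
  simp only [holds_atomFormula_iff]
  exact hC _

/-- A strategy by which a variable denotes the number `n`. -/
def choose (n : ℕ) : Strategy standardGame := fun _ => (0, fun _ => n)

@[simp]
theorem value_choose (j : Fin numVars) (n : ℕ) : value j (choose n) = n := rfl

theorem holds_var_eq_var_iff {a : ℕ → Strategy standardGame} {i j : Fin numVars} :
    Holds standardGame .root a (sameMarks (varTerm i) (varTerm j)) ↔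
      value i (a (i + 3)) = value j (a (j + 3)) := by
  rw [holds_var_eq_var, varDen_eq, varDen_eq, setOf_marks_inj]

theorem holds_theory (a : ℕ → Strategy standardGame) (c : Code) :
    Holds standardGame .root a (theoryFormula c) := by
  refine holds_theoryFormula.2 ⟨holds_existsZero.2 ⟨choose 0, ?_⟩,
    holds_existsSucc.2 ⟨choose (value 0 (a 3) + 1), ?_, choose (value 0 (a 3) + 1), ?_⟩,
    fun j => (holds_existsCopy j).2 ⟨choose (value 0 (a 3)), ?_⟩,
    fun C hC => holds_clauseFormula_of_standard (standard_arithClauses hC),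
    fun C hC => holds_clauseFormula_of_standard (standard_codeClauses hC)⟩
  · simp [holds_atomFormula_iff, AtomTrue, zeroAtom]
  · simp [holds_atomFormula_iff, AtomTrue, succAtom]
  · simp [holds_var_eq_var_iff]
  · rw [holds_var_eq_var_iff, Function.update_self, value_choose]
    by_cases hj : j = 0
    · subst hj; simp
    · rw [Function.update_of_ne fun e => hj (Fin.ext (Nat.add_right_cancel e).symm)]
      rfl

theorem holds_numeral (a : ℕ → Strategy standardGame) (n : ℕ) :
    Holds standardGame .root a (numeralFormula n) := by
  induction n with
  | zero =>
    refine holds_clauseFormula_of_standard fun ρ h => ?_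
    simpa [AtomTrue, zeroAtom, numAtom] using h
  | succ k ih =>
    refine ⟨ih, holds_clauseFormula_of_standard fun ρ h => ?_⟩
    simp [AtomTrue, succAtom, numAtom] at h ⊢
    omega

theorem holds_divergenceMatrix {c : Code} {n : ℕ} (h : ¬ (c.eval n).Dom)
    (a : ℕ → Strategy standardGame) : Holds standardGame .root a (divergenceMatrix c n) := by
  refine ⟨holds_theory a c, holds_numeral a n, fun ⟨h₁, h₂⟩ => h ?_⟩
  replace h₁ := holds_atomFormula_iff.1 h₁
  replace h₂ := holds_atomFormula_iff.1 h₂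
  simp only [AtomTrue, numAtom, codeAtom, standard_numSym, standard_codeSym] at h₁ h₂
  rw [← h₁]
  exact Part.dom_iff_mem.2 ⟨_, h₂⟩

end StandardGame

theorem satTB_divergenceFormula_iff {c : Code} {n : ℕ} :
    SatTB (divergenceFormula c n) ↔ ¬ (c.eval n).Dom := by
  constructor
  · rintro ⟨G, -, s, h⟩
    exact not_dom_of_holds ((stateSat_always (isStateFormula_divergenceMatrix c n)).1 h)
  · intro h
    exact ⟨standardGame, turnBased_standardGame, .root,
      (stateSat_always (isStateFormula_divergenceMatrix c n)).2
        (StandardGame.holds_divergenceMatrix h)⟩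

/-! ### Computability of the reduction -/

section Computability

/-- A family of formulas whose codes are primitive recursive in the index. -/
def PrimrecFamily (T : ℕ → Formula) : Prop := Primrec fun n => encodeF (T n)

theorem primrecFamily_const (φ : Formula) : PrimrecFamily fun _ => φ := Primrec.const _

variable {T U : ℕ → Formula}

theorem primrecFamily_atom {g : ℕ → ℕ} (hg : Primrec g) :
    PrimrecFamily fun n => .atom (g n) :=
  Primrec₂.natPair.comp (Primrec.const 0) hg

theorem PrimrecFamily.neg (hT : PrimrecFamily T) : PrimrecFamily fun n => .neg (T n) :=
  Primrec₂.natPair.comp (Primrec.const 1) hT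

theorem PrimrecFamily.conj (hT : PrimrecFamily T) (hU : PrimrecFamily U) :
    PrimrecFamily fun n => .conj (T n) (U n) :=
  Primrec₂.natPair.comp (Primrec.const 2) (Primrec₂.natPair.comp hT hU)

theorem PrimrecFamily.next (hT : PrimrecFamily T) : PrimrecFamily fun n => .next (T n) :=
  Primrec₂.natPair.comp (Primrec.const 3) hT

theorem PrimrecFamily.strat (A : List ℕ) (hT : PrimrecFamily T) :
    PrimrecFamily fun n => .strat A (T n) :=
  Primrec₂.natPair.comp (Primrec.const 5)
    (Primrec₂.natPair.comp (Primrec.const (Encodable.encode A)) hT)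

theorem primrecFamily_numAtom {g : ℕ → ℕ} (hg : Primrec g) (i : Fin numVars) :
    PrimrecFamily fun n => atomFormula (numAtom (g n) i) := by
  have hsym : Primrec fun n => numSym (g n) := Primrec₂.natPair.comp (Primrec.const 6) hg
  have hlabel : PrimrecFamily fun n => box [2] (factLabelled (numSym (g n))) :=
    ((((primrecFamily_const (.atom 2)).conj
      (primrecFamily_atom hsym).next).next.strat [0]).neg.strat _).neg
  exact (hlabel.conj (primrecFamily_const (.conj (sameMarks (varTerm i) (componentTerm 0))
    (.conj (sameMarks (varTerm i) (componentTerm 1))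
      (sameMarks (varTerm i) (componentTerm 2)))))).strat [2]

theorem primrecFamily_numeralFormula : PrimrecFamily numeralFormula := by
  have hclause : PrimrecFamily fun k =>
      clauseFormula ([numAtom k 0, succAtom 0 1], numAtom (k + 1) 1) :=
    (((primrecFamily_numAtom Primrec.id 0).conj
      (primrecFamily_const (conjList [atomFormula (succAtom 0 1)]))).conj
        (primrecFamily_numAtom Primrec.succ 1).neg).neg
  have hstep : Primrec₂ fun k m : ℕ => Nat.pair 2 (Nat.pair m
      (encodeF (clauseFormula ([numAtom k 0, succAtom 0 1], numAtom (k + 1) 1)))) :=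
    Primrec₂.natPair.comp (Primrec.const 2)
      (Primrec₂.natPair.comp Primrec.snd (hclause.comp Primrec.fst))
  refine (Primrec.nat_rec₁ (encodeF (numeralFormula 0)) hstep).of_eq fun n => ?_
  induction n with
  | zero => rfl
  | succ k ih =>
    have hk : encodeF (numeralFormula (k + 1)) = Nat.pair 2 (Nat.pair (encodeF (numeralFormula k))
      (encodeF (clauseFormula ([numAtom k 0, succAtom 0 1], numAtom (k + 1) 1)))) := rfl
    rw [hk, ← ih]

theorem primrecFamily_divergenceFormula (c : Code) : PrimrecFamily (divergenceFormula c) :=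
  (((primrecFamily_const (theoryFormula c)).conj (primrecFamily_numeralFormula.conj
    ((primrecFamily_numAtom Primrec.id 0).conj
      (primrecFamily_const (atomFormula (codeAtom c 0 1)))).neg)).neg.strat _).neg

end Computability

/-- A code that runs a given code on the input `0`. -/
theorem exists_universal_code :
    ∃ c : Code, ∀ d : Code, c.eval (Encodable.encode d) = d.eval 0 := by
  have h : Partrec fun n : ℕ => (Denumerable.ofNat Code n).eval 0 :=
    Code.eval_part.comp (Computable.ofNat Code) (Computable.const 0)
  obtain ⟨c, hc⟩ := Code.exists_code.1 (Partrec.nat_iff.1 h)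
  exact ⟨c, fun d => by simp [hc]⟩

end ATLsc

/-- **Theorem (undecidability of ATL_sc^0 satisfiability over turn-based games).**
There is no algorithm that, given an ATL_sc^0 formula (with memoryless-strategy
quantification), decides whether there exist a turn-based concurrent game structure
and a state of it satisfying the formula under the empty strategy context. -/
theorem satisfiability_ATLsc0_turnBased_undecidable :
    ¬ ∃ f : ℕ → Bool, Computable f ∧
      ∀ φ : Formula, (f (encodeF φ) = true ↔ SatTB φ) := by
  rintro ⟨f, hf, hsat⟩
  obtain ⟨c, hc⟩ := ATLsc.exists_universal_code
  refine ComputablePred.halting_problem 0 (ComputablePred.computable_iff.2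
    ⟨fun d => !f (encodeF (ATLsc.divergenceFormula c (Encodable.encode d))), ?_, ?_⟩)
  · exact Primrec.not.to_comp.comp
      (hf.comp ((ATLsc.primrecFamily_divergenceFormula c).to_comp.comp Computable.encode))
  · funext d
    have h := (hsat (ATLsc.divergenceFormula c (Encodable.encode d))).trans
      ATLsc.satTB_divergenceFormula_iff
    rw [hc] at h
    simp [← Bool.not_eq_true, h]
end

section
/- The satisfiability problem for ATL_sc^0 with memoryless-strategy quantification over (possibly infinite-state) turn-based game structures is undecidable: the problem of tiling the quadrant ℕ×ℕ many-one reduces to it. -/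
/-- A tile system: tiles are `0, …, numTiles - 1`, with horizontal and vertical
matching relations given as finite lists of pairs. -/
structure TileSystem : Type where
  numTiles : ℕ
  H : List (ℕ × ℕ)
  V : List (ℕ × ℕ)

/-- The tile system admits a tiling of the quadrant ℕ×ℕ. -/
def TilesQuadrant (ts : TileSystem) : Prop :=
  ∃ τ : ℕ → ℕ → ℕ, (∀ i j, τ i j < ts.numTiles) ∧
    (∀ i j, (τ i j, τ (i + 1) j) ∈ ts.H) ∧
    (∀ i j, (τ i j, τ i (j + 1)) ∈ ts.V)

/-- An explicit encoding of tile systems as natural numbers. -/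
def encodeTS (ts : TileSystem) : ℕ := Encodable.encode (ts.numTiles, ts.H, ts.V)

/-- The quadrant-tiling problem, as a set of natural numbers (codes of tile systems
admitting a tiling of ℕ×ℕ). -/
def TilingProblem (n : ℕ) : Prop := ∃ ts : TileSystem, encodeTS ts = n ∧ TilesQuadrant ts

/-- The satisfiability problem for ATL_sc^0 (with memoryless-strategy quantification)
over turn-based game structures, as a set of natural numbers (codes of satisfiable
formulas). -/
def SatTBProblem (n : ℕ) : Prop := ∃ φ : Formula, encodeF φ = n ∧ SatTB φ

/-! ## One-step semantics of state formulas -/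

namespace CGS

/-- `s'` is a successor of `s` compatible with the context `ctx`. -/
def Succ (G : CGS) (ctx : Ctx G) (s s' : G.State) : Prop :=
  ∃ mv : ℕ → G.Move, (∀ p σ, ctx p = some σ → mv p = σ s) ∧ s' = G.trans s mv

/-- The context obtained from `ctx` by giving player `p` the strategy `σ`. -/
def setStrategy (G : CGS) (ctx : Ctx G) (p : ℕ) (σ : G.State → G.Move) : Ctx G :=
  fun q => if q = p then some σ else ctx q

variable {G : CGS} {ctx : Ctx G} {s s' : G.State} {p : ℕ} {σ : G.State → G.Move}

@[simp] theorem setStrategy_same : G.setStrategy ctx p σ p = some σ := by simp [setStrategy]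

theorem setStrategy_of_ne {q : ℕ} (h : q ≠ p) : G.setStrategy ctx p σ q = ctx q := by
  simp [setStrategy, h]

@[simp] theorem emptyCtx_apply : emptyCtx G p = none := rfl

theorem exists_compatible_moves (ctx : Ctx G) (s : G.State) (m : G.Move) :
    ∃ mv : ℕ → G.Move, (∀ p σ, ctx p = some σ → mv p = σ s) ∧ ∀ p, ctx p = none → mv p = m := by
  refine ⟨fun p => ((ctx p).map (fun σ => σ s)).getD m, fun p σ h => ?_, fun p h => ?_⟩ <;>
    simp [h]

theorem exists_succ (ctx : Ctx G) (s : G.State) : ∃ s', G.Succ ctx s s' := by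
  obtain ⟨m⟩ := G.move_nonempty
  obtain ⟨mv, h, -⟩ := exists_compatible_moves ctx s m
  exact ⟨_, mv, h, rfl⟩

theorem Succ.of_empty (hc : Controls G p s) (hp : ctx p = none)
    (h : G.Succ (emptyCtx G) s s') : G.Succ ctx s s' := by
  obtain ⟨mv, -, rfl⟩ := h
  obtain ⟨mv', h', hm⟩ := exists_compatible_moves ctx s (mv p)
  exact ⟨mv', h', hc _ _ (hm p hp).symm⟩

theorem Succ.to_empty (h : G.Succ ctx s s') : G.Succ (emptyCtx G) s s' := by
  obtain ⟨mv, -, rfl⟩ := h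
  exact ⟨mv, by simp, rfl⟩

theorem succ_empty_const (s : G.State) (m : G.Move) :
    G.Succ (emptyCtx G) s (G.trans s fun _ => m) := ⟨_, by simp, rfl⟩

theorem succ_iff_of_controls_empty (hc : Controls G p s) :
    G.Succ (emptyCtx G) s s' ↔ ∃ m, s' = G.trans s fun _ => m := by
  constructor
  · rintro ⟨mv, -, rfl⟩
    exact ⟨mv p, hc _ _ rfl⟩
  · rintro ⟨m, rfl⟩
    exact succ_empty_const s m

theorem succ_iff_of_controls (hc : Controls G p s) (hp : ctx p = some σ) :
    G.Succ ctx s s' ↔ s' = G.trans s fun _ => σ s := by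
  constructor
  · rintro ⟨mv, h, rfl⟩
    exact hc _ _ (h p σ hp)
  · rintro rfl
    obtain ⟨mv, h, -⟩ := exists_compatible_moves ctx s (σ s)
    exact ⟨mv, h, hc _ _ (h p σ hp).symm⟩

theorem succ_of_isOutcome {π : ℕ → G.State} (h : IsOutcome G ctx s π) :
    G.Succ ctx s (π 1) := by
  have h' : G.Succ ctx (π 0) (π 1) := h.2 0
  rwa [h.1] at h'

theorem exists_outcome (ctx : Ctx G) (s : G.State) : ∃ π, IsOutcome G ctx s π := by
  choose f hf using fun s => exists_succ ctx s
  refine ⟨fun n => f^[n] s, rfl, fun i => ?_⟩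
  have := hf (f^[i] s)
  rwa [← Function.iterate_succ_apply' f] at this

theorem isOutcome_cons {π : ℕ → G.State} (hs : G.Succ ctx s s') (h : IsOutcome G ctx s' π) :
    IsOutcome G ctx s (fun n => Nat.casesOn n s π) := by
  refine ⟨rfl, fun i => ?_⟩
  cases i with
  | zero =>
    have h0 : π 0 = s' := h.1
    subst h0
    exact hs
  | succ i => exact h.2 i

/-- Reachability under a context. -/
def Reach (G : CGS) (ctx : Ctx G) : G.State → G.State → Prop := Relation.ReflTransGen (G.Succ ctx)

theorem exists_outcome_of_reach (h : G.Reach ctx s s') :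
    ∃ π j, IsOutcome G ctx s π ∧ π j = s' := by
  induction h using Relation.ReflTransGen.head_induction_on with
  | refl =>
    obtain ⟨π, hπ⟩ := exists_outcome ctx s'
    exact ⟨π, 0, hπ, hπ.1⟩
  | head hs _ ih =>
    obtain ⟨π, j, hπ, rfl⟩ := ih
    exact ⟨_, j + 1, isOutcome_cons hs hπ, rfl⟩

theorem reach_of_isOutcome {π : ℕ → G.State} (h : IsOutcome G ctx s π) (j : ℕ) :
    G.Reach ctx s (π j) := by
  induction j with
  | zero => rw [h.1]; exact .refl
  | succ j ih => exact ih.tail (h.2 j)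

end CGS

namespace Formula

/-- Formulas whose truth on a path only depends on the first state. -/
def IsState : Formula → Prop
  | atom _ => True
  | neg φ => φ.IsState
  | conj φ ψ => φ.IsState ∧ ψ.IsState
  | next _ => False
  | untl _ _ => False
  | strat _ _ => True

theorem isState_atom (a : ℕ) : (atom a).IsState := trivial

/-- Truth of a formula on the constant path; the intended use is for state formulas. -/
def Holds (G : CGS) (ctx : Ctx G) (s : G.State) (φ : Formula) : Prop := sat G φ ctx fun _ => s

theorem sat_iff_holds {G : CGS} {ctx : Ctx G} {φ : Formula} (h : φ.IsState) (π : ℕ → G.State) :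
    sat G φ ctx π ↔ Holds G ctx (π 0) φ := by
  induction φ with
  | atom | strat => rfl
  | neg φ ih => exact not_congr (ih h)
  | conj φ ψ ihφ ihψ => exact and_congr (ihφ h.1) (ihψ h.2)
  | next | untl => exact h.elim

/-- The disjunction of two formulas. -/
def disj (φ ψ : Formula) : Formula := neg (conj (neg φ) (neg ψ))

/-- Some successor satisfies `φ`. -/
def exNext (φ : Formula) : Formula := neg (strat [] (neg (next φ)))

/-- All successors satisfy `φ`. -/
def allNext (φ : Formula) : Formula := neg (exNext (neg φ))

/-- Player `p` can force `φ` to hold in the next state. -/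
def force (p : ℕ) (φ : Formula) : Formula := strat [p] (next φ)

/-- Player `p` can force `φ` as well as its negation to hold in the next state. -/
def decides (p : ℕ) (φ : Formula) : Formula := conj (force p φ) (force p (neg φ))

/-- All strategies of player `p` satisfy `φ`. -/
def forallStrategy (p : ℕ) (φ : Formula) : Formula := neg (strat [p] (neg φ))

/-- All reachable states satisfy `φ`. -/
def globally (φ : Formula) : Formula :=
  strat [] (neg (untl (neg (conj (atom 0) (neg (atom 0)))) (neg φ)))

section Semantics

variable {G : CGS} {ctx : Ctx G} {s : G.State} {φ ψ : Formula} {p : ℕ}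

@[simp] theorem holds_atom {a : ℕ} : Holds G ctx s (atom a) ↔ G.label s a := Iff.rfl

@[simp] theorem holds_neg : Holds G ctx s (neg φ) ↔ ¬ Holds G ctx s φ := Iff.rfl

@[simp] theorem holds_conj : Holds G ctx s (conj φ ψ) ↔ Holds G ctx s φ ∧ Holds G ctx s ψ := Iff.rfl

@[simp] theorem holds_disj : Holds G ctx s (disj φ ψ) ↔ Holds G ctx s φ ∨ Holds G ctx s ψ := by
  simp only [disj, holds_neg, holds_conj]
  tauto

theorem holds_strat_nil :
    Holds G ctx s (strat [] φ) ↔ ∀ π, IsOutcome G ctx s π → sat G φ ctx π := by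
  constructor
  · rintro ⟨ctx', h, -, h'⟩
    obtain rfl : ctx' = ctx := funext fun p => h p (by simp)
    exact h'
  · exact fun h => ⟨ctx, fun _ _ => rfl, by simp, h⟩

theorem holds_strat_singleton :
    Holds G ctx s (strat [p] φ) ↔
      ∃ σ, ∀ π, IsOutcome G (G.setStrategy ctx p σ) s π → sat G φ (G.setStrategy ctx p σ) π := by
  constructor
  · rintro ⟨ctx', h, hp, h'⟩
    obtain ⟨σ, hσ⟩ := hp p (by simp)
    obtain rfl : ctx' = G.setStrategy ctx p σ := by
      funext q
      by_cases hq : q = p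
      · subst hq; simp [hσ]
      · rw [CGS.setStrategy_of_ne hq, h q (by simpa using hq)]
    exact ⟨σ, h'⟩
  · rintro ⟨σ, h⟩
    refine ⟨G.setStrategy ctx p σ, fun q hq => CGS.setStrategy_of_ne (by simpa using hq),
      fun q hq => ⟨σ, ?_⟩, h⟩
    obtain rfl : q = p := by simpa using hq
    simp

theorem holds_exNext (h : φ.IsState) :
    Holds G ctx s (exNext φ) ↔ ∃ s', G.Succ ctx s s' ∧ Holds G ctx s' φ := by
  rw [exNext, holds_neg, holds_strat_nil]
  push Not
  constructor
  · rintro ⟨π, hπ, hs⟩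
    exact ⟨π 1, CGS.succ_of_isOutcome hπ, (sat_iff_holds h _).1 (not_not.1 hs)⟩
  · rintro ⟨s', hs, hφ⟩
    obtain ⟨π, hπ⟩ := CGS.exists_outcome ctx s'
    refine ⟨_, CGS.isOutcome_cons hs hπ, not_not.2 ((sat_iff_holds h _).2 ?_)⟩
    simpa [hπ.1] using hφ

theorem holds_allNext (h : φ.IsState) :
    Holds G ctx s (allNext φ) ↔ ∀ s', G.Succ ctx s s' → Holds G ctx s' φ := by
  rw [allNext, holds_neg, holds_exNext (φ := neg φ) h]
  simp

theorem holds_forallStrategy (h : φ.IsState) :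
    Holds G ctx s (forallStrategy p φ) ↔ ∀ σ, Holds G (G.setStrategy ctx p σ) s φ := by
  rw [forallStrategy, holds_neg, holds_strat_singleton, not_exists]
  refine forall_congr' fun σ => ?_
  push Not
  constructor
  · rintro ⟨π, hπ, hs⟩
    simpa [hπ.1] using (sat_iff_holds h _).1 (not_not.1 hs)
  · intro hφ
    obtain ⟨π, hπ⟩ := CGS.exists_outcome (G.setStrategy ctx p σ) s
    exact ⟨π, hπ, not_not.2 ((sat_iff_holds h _).2 (by rwa [hπ.1]))⟩

theorem holds_force (h : φ.IsState) :
    Holds G ctx s (force p φ) ↔ ∃ σ, ∀ s', G.Succ (G.setStrategy ctx p σ) s s' →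
      Holds G (G.setStrategy ctx p σ) s' φ := by
  rw [force, holds_strat_singleton]
  refine exists_congr fun σ => ⟨fun H s' hs => ?_, fun H π hπ => ?_⟩
  · obtain ⟨π, hπ⟩ := CGS.exists_outcome (G.setStrategy ctx p σ) s'
    have := (sat_iff_holds h _).1 (H _ (CGS.isOutcome_cons hs hπ))
    simpa [hπ.1] using this
  · exact (sat_iff_holds h _).2 (H _ (CGS.succ_of_isOutcome hπ))

theorem holds_force_atom (hc : Controls G p s) {a : ℕ} :
    Holds G ctx s (force p (atom a)) ↔ ∃ m, G.label (G.trans s fun _ => m) a := by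
  rw [holds_force (isState_atom a)]
  constructor
  · rintro ⟨σ, h⟩
    exact ⟨σ s, h _ ((CGS.succ_iff_of_controls hc CGS.setStrategy_same).2 rfl)⟩
  · rintro ⟨m, h⟩
    refine ⟨fun _ => m, fun s' hs => ?_⟩
    rw [CGS.succ_iff_of_controls hc CGS.setStrategy_same] at hs
    simpa [hs] using h

theorem holds_force_neg_atom (hc : Controls G p s) {a : ℕ} :
    Holds G ctx s (force p (neg (atom a))) ↔ ∃ m, ¬ G.label (G.trans s fun _ => m) a := by
  rw [holds_force (φ := neg (atom a)) (isState_atom a)]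
  constructor
  · rintro ⟨σ, h⟩
    exact ⟨σ s, h _ ((CGS.succ_iff_of_controls hc CGS.setStrategy_same).2 rfl)⟩
  · rintro ⟨m, h⟩
    refine ⟨fun _ => m, fun s' hs => ?_⟩
    rw [CGS.succ_iff_of_controls hc CGS.setStrategy_same] at hs
    simpa [hs] using h

/-- In a turn-based structure, the only player deciding a proposition is the one in control. -/
theorem holds_decides_atom (tb : TurnBased G) {a : ℕ} :
    Holds G (emptyCtx G) s (decides p (atom a)) ↔ Controls G p s ∧
      (∃ m, G.label (G.trans s fun _ => m) a) ∧ ∃ m, ¬ G.label (G.trans s fun _ => m) a := by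
  refine ⟨fun h => ?_, fun ⟨hc, h₁, h₂⟩ =>
    ⟨(holds_force_atom hc).2 h₁, (holds_force_neg_atom hc).2 h₂⟩⟩
  suffices hc : Controls G p s from
    ⟨hc, (holds_force_atom hc).1 h.1, (holds_force_neg_atom hc).1 h.2⟩
  obtain ⟨q, hq⟩ := tb s
  obtain rfl | hpq := eq_or_ne q p
  · exact hq
  obtain ⟨m⟩ := G.move_nonempty
  have key : ∀ σ, G.Succ (G.setStrategy (emptyCtx G) p σ) s (G.trans s fun _ => m) := fun σ =>
    CGS.Succ.of_empty hq (by simp [CGS.setStrategy_of_ne hpq]) (CGS.succ_empty_const s m)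
  obtain ⟨σ, h₁⟩ := (holds_force (isState_atom a)).1 h.1
  obtain ⟨σ', h₂⟩ := (holds_force (φ := neg (atom a)) (isState_atom a)).1 h.2
  exact absurd (h₁ _ (key σ)) (h₂ _ (key σ'))

theorem holds_globally (h : φ.IsState) :
    Holds G ctx s (globally φ) ↔ ∀ s', G.Reach ctx s s' → Holds G ctx s' φ := by
  rw [globally, holds_strat_nil]
  constructor
  · intro H s' hs
    obtain ⟨π, j, hπ, rfl⟩ := CGS.exists_outcome_of_reach hs
    by_contra hφ
    refine H π hπ ⟨j, fun hs => hφ ?_, fun k _ hk => hk.2 hk.1⟩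
    simpa using (sat_iff_holds h _).1 hs
  · rintro H π hπ ⟨j, hj, -⟩
    refine hj ((sat_iff_holds h _).2 ?_)
    simpa using H _ (CGS.reach_of_isOutcome hπ j)

end Semantics

end Formula

/-! ## Unary function structures and their local formulas -/

/-- A labelled set with `k` unary functions. -/
structure UnaryStruct (k : ℕ) : Type 1 where
  D : Type
  fn : Fin k → D → D
  lab : D → ℕ → Prop

namespace UnaryStruct

variable {k : ℕ} (S : UnaryStruct k)

/-- Apply the functions of a word one after the other, starting with the head. -/
def run (w : List (Fin k)) (x : S.D) : S.D := w.foldl (fun y i => S.fn i y) x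

@[simp] theorem run_nil (x : S.D) : S.run [] x = x := rfl

@[simp] theorem run_cons (i : Fin k) (w : List (Fin k)) (x : S.D) :
    S.run (i :: w) x = S.run w (S.fn i x) := rfl

end UnaryStruct

/-- Local formulas over structures with `k` unary functions. -/
inductive Loc (k : ℕ) : Type where
  | atom : ℕ → Loc k
  | neg : Loc k → Loc k
  | conj : Loc k → Loc k → Loc k
  | app : Fin k → Loc k → Loc k
  | eq : List (Fin k) → List (Fin k) → Loc k

namespace Loc

variable {k : ℕ}

/-- Truth of a local formula at an element. -/
def Eval (S : UnaryStruct k) : Loc k → S.D → Prop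
  | atom n, x => S.lab x n
  | neg φ, x => ¬ φ.Eval S x
  | conj φ ψ, x => φ.Eval S x ∧ ψ.Eval S x
  | app i φ, x => φ.Eval S (S.fn i x)
  | eq w w', x => S.run w x = S.run w' x

end Loc

namespace Formula

/-- The atom marking the nodes from which the `i`-th function is applied. -/
def fnAtom (i : ℕ) : ℕ := 2 * i + 4

/-- The atom representing the `n`-th label. -/
def labAtom (n : ℕ) : ℕ := 2 * n + 3

/-- Some value of the `i`-th function at the current state satisfies `φ`. -/
def exApp (i : ℕ) (φ : Formula) : Formula :=
  exNext (exNext (conj (atom 2) (exNext (conj (atom (fnAtom i)) (exNext (conj (atom 0) φ))))))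

/-- Some state reached along a word of functions satisfies `φ`. -/
def exWord {k : ℕ} : List (Fin k) → Formula → Formula
  | [], φ => φ
  | i :: w, φ => exApp i (exWord w φ)

/-- Two words of functions lead to the same state: no strategy of player `1` separates their
endpoints. -/
def wordEq {k : ℕ} (w w' : List (Fin k)) : Formula :=
  forallStrategy 1 (neg (conj (exWord w (exNext (atom 1))) (exWord w' (exNext (neg (atom 1))))))

/-- The formula of the game logic representing a local formula. -/
def ofLoc {k : ℕ} : Loc k → Formula
  | .atom n => atom (labAtom n)
  | .neg φ => neg (ofLoc φ)
  | .conj φ ψ => conj (ofLoc φ) (ofLoc ψ)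
  | .app i φ => exApp i (ofLoc φ)
  | .eq v w => wordEq v w

/-- The conjunction of a list of formulas. -/
def allOf (l : List Formula) : Formula := l.foldr conj (neg (conj (atom 0) (neg (atom 0))))

/-- The behaviour of the states where player `0` selects a function. -/
def core (k : ℕ) : Formula :=
  conj (decides 0 (atom (fnAtom 0)))
    (conj (allOf ((List.finRange k).map fun i : Fin k => force 0 (atom (fnAtom i))))
      (allNext (decides 3 (atom 0))))

/-- The state where player `0` selects a function is unique. -/
def uniqueCore : Formula :=
  forallStrategy 0 (neg (conj (exNext (exNext (conj (atom 2) (exNext (atom (fnAtom 0))))))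
    (exNext (exNext (conj (atom 2) (exNext (neg (atom (fnAtom 0)))))))))

/-- The behaviour of the states representing elements. -/
def cell (k : ℕ) : Formula :=
  conj (decides 1 (atom 1)) (conj (allNext (decides 3 (atom 2)))
    (conj (allNext (allNext (disj (neg (atom 2)) (core k)))) uniqueCore))

/-- The functions are well-defined. -/
def functional (k : ℕ) : Formula :=
  allOf ((List.finRange k).map fun i : Fin k => wordEq [i] [i])

/-- The formula expressing that `root` holds somewhere and `glob` everywhere in a unary function
structure. -/
def describe {k : ℕ} (root glob : Loc k) : Formula :=
  conj (conj (atom 0) (ofLoc root))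
    (globally (disj (neg (atom 0)) (conj (conj (cell k) (functional k)) (ofLoc glob))))

end Formula

/-- One application of the `i`-th function in a game structure. -/
def CGS.AppStep (G : CGS) (ctx : Ctx G) (i : ℕ) (s t : G.State) : Prop :=
  ∃ s₁ s₂ s₃, G.Succ ctx s s₁ ∧ G.Succ ctx s₁ s₂ ∧ G.label s₂ 2 ∧ G.Succ ctx s₂ s₃ ∧
    G.label s₃ (Formula.fnAtom i) ∧ G.Succ ctx s₃ t ∧ G.label t 0

/-- The semantic content of `Formula.cell`. -/
structure CGS.IsCell (G : CGS) (k : ℕ) (s : G.State) : Prop where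
  controls : Controls G 1 s
  pos : ∃ m, G.label (G.trans s fun _ => m) 1
  neg : ∃ m, ¬ G.label (G.trans s fun _ => m) 1
  side : ∀ s₁, G.Succ (emptyCtx G) s s₁ → Controls G 3 s₁ ∧
    (∃ m, G.label (G.trans s₁ fun _ => m) 2) ∧ ∃ m, ¬ G.label (G.trans s₁ fun _ => m) 2
  core : ∀ s₁ s₂, G.Succ (emptyCtx G) s s₁ → G.Succ (emptyCtx G) s₁ s₂ → G.label s₂ 2 →
    (Controls G 0 s₂ ∧ (∃ m, G.label (G.trans s₂ fun _ => m) (Formula.fnAtom 0)) ∧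
      ∃ m, ¬ G.label (G.trans s₂ fun _ => m) (Formula.fnAtom 0)) ∧
    (∀ i : Fin k, ∃ m, G.label (G.trans s₂ fun _ => m) (Formula.fnAtom i)) ∧
    ∀ s₃, G.Succ (emptyCtx G) s₂ s₃ → Controls G 3 s₃ ∧
      (∃ m, G.label (G.trans s₃ fun _ => m) 0) ∧ ∃ m, ¬ G.label (G.trans s₃ fun _ => m) 0
  unique : ∀ s₁ s₂ s₁' s₂', G.Succ (emptyCtx G) s s₁ → G.Succ (emptyCtx G) s₁ s₂ → G.label s₂ 2 →
    G.Succ (emptyCtx G) s s₁' → G.Succ (emptyCtx G) s₁' s₂' → G.label s₂' 2 → s₂ = s₂'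

namespace Formula

section

variable {G : CGS} {ctx : Ctx G} {s : G.State} {φ ψ : Formula} {k : ℕ}

theorem isState_exWord (w : List (Fin k)) (h : φ.IsState) : (exWord w φ).IsState := by
  cases w <;> trivial

theorem isState_ofLoc (φ : Loc k) : (ofLoc φ).IsState := by
  induction φ with
  | atom | app | eq => trivial
  | neg φ ih => exact ih
  | conj φ ψ ihφ ihψ => exact ⟨ihφ, ihψ⟩

theorem isState_allOf {l : List Formula} (h : ∀ φ ∈ l, φ.IsState) : (allOf l).IsState := by
  induction l with
  | nil => exact ⟨trivial, trivial⟩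
  | cons φ l ih => exact ⟨h φ (by simp), ih fun ψ hψ => h ψ (by simp [hψ])⟩

theorem holds_allOf {l : List Formula} :
    Holds G ctx s (allOf l) ↔ ∀ φ ∈ l, Holds G ctx s φ := by
  induction l with
  | nil => simp [allOf]
  | cons φ l ih => rw [allOf, List.foldr_cons, holds_conj, ← allOf, ih]; simp

theorem isState_core : (core k).IsState :=
  ⟨⟨trivial, trivial⟩, isState_allOf (by simp [force, IsState]), trivial⟩

theorem isState_cell : (cell k).IsState := ⟨⟨trivial, trivial⟩, trivial, trivial, trivial⟩

theorem isState_functional : (functional k).IsState :=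
  isState_allOf (by simp [wordEq, forallStrategy, IsState])

theorem holds_exNext_atom {a : ℕ} :
    Holds G ctx s (exNext (atom a)) ↔ ∃ s', G.Succ ctx s s' ∧ G.label s' a :=
  holds_exNext (isState_atom a)

theorem holds_exNext_neg_atom {a : ℕ} :
    Holds G ctx s (exNext (neg (atom a))) ↔ ∃ s', G.Succ ctx s s' ∧ ¬ G.label s' a :=
  holds_exNext (φ := neg (atom a)) (isState_atom a)

theorem holds_exApp (h : φ.IsState) {i : ℕ} : Holds G ctx s (exApp i φ) ↔
    ∃ s', G.AppStep ctx i s s' ∧ Holds G ctx s' φ := by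
  rw [exApp, holds_exNext (φ := exNext _) trivial]
  simp only [holds_exNext (φ := conj (atom _) (exNext _)) ⟨trivial, trivial⟩,
    holds_exNext (φ := conj (atom _) φ) ⟨trivial, h⟩, holds_conj, holds_atom, CGS.AppStep]
  constructor
  · rintro ⟨s₁, h₁, s₂, h₂, hC, s₃, h₃, hF, s₄, h₄, hA, hφ⟩
    exact ⟨s₄, ⟨s₁, s₂, s₃, h₁, h₂, hC, h₃, hF, h₄, hA⟩, hφ⟩
  · rintro ⟨s₄, ⟨s₁, s₂, s₃, h₁, h₂, hC, h₃, hF, h₄, hA⟩, hφ⟩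
    exact ⟨s₁, h₁, s₂, h₂, hC, s₃, h₃, hF, s₄, h₄, hA, hφ⟩

/-- A function may take prescribed values at two distinct points. -/
theorem exists_separating {α β : Type} {x y : α} (h : x ≠ y) (m m' : β) :
    ∃ σ : α → β, σ x = m ∧ σ y = m' := by
  classical
  exact ⟨fun z => if z = x then m else m', by simp, by simp [h.symm]⟩

theorem holds_uniqueCore_iff (h₁ : Controls G 1 s)
    (h₂ : ∀ s₁, G.Succ (emptyCtx G) s s₁ → Controls G 3 s₁)
    (h₃ : ∀ s₁ s₂, G.Succ (emptyCtx G) s s₁ → G.Succ (emptyCtx G) s₁ s₂ → G.label s₂ 2 →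
      Controls G 0 s₂ ∧ (∃ m, G.label (G.trans s₂ fun _ => m) (Formula.fnAtom 0)) ∧
      ∃ m, ¬ G.label (G.trans s₂ fun _ => m) (Formula.fnAtom 0)) :
    Holds G (emptyCtx G) s uniqueCore ↔
      ∀ s₁ s₂ s₁' s₂', G.Succ (emptyCtx G) s s₁ → G.Succ (emptyCtx G) s₁ s₂ → G.label s₂ 2 →
        G.Succ (emptyCtx G) s s₁' → G.Succ (emptyCtx G) s₁' s₂' → G.label s₂' 2 → s₂ = s₂' := by
  rw [uniqueCore, holds_forallStrategy (φ := neg (conj (exNext _) (exNext _))) ⟨trivial, trivial⟩]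
  simp only [holds_neg, holds_conj, holds_exNext (φ := exNext _) trivial, holds_atom,
    holds_exNext (φ := conj (atom _) (exNext _)) ⟨trivial, trivial⟩,
    holds_exNext_atom, holds_exNext_neg_atom]
  constructor
  · intro H s₁ s₂ s₁' s₂' a₁ a₂ a₃ b₁ b₂ b₃
    by_contra hne
    obtain ⟨hc, ⟨m, hm⟩, -⟩ := h₃ _ _ a₁ a₂ a₃
    obtain ⟨hc', -, m', hm'⟩ := h₃ _ _ b₁ b₂ b₃
    obtain ⟨σ, rfl, rfl⟩ := exists_separating hne m m'
    refine H σ ⟨⟨s₁, a₁.of_empty h₁ rfl, s₂, a₂.of_empty (h₂ _ a₁) rfl, a₃, _,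
      (CGS.succ_iff_of_controls hc CGS.setStrategy_same).2 rfl, hm⟩,
      ⟨s₁', b₁.of_empty h₁ rfl, s₂', b₂.of_empty (h₂ _ b₁) rfl, b₃, _,
      (CGS.succ_iff_of_controls hc' CGS.setStrategy_same).2 rfl, hm'⟩⟩
  · rintro H σ ⟨⟨s₁, a₁, s₂, a₂, a₃, t, a₄, a₅⟩, ⟨s₁', b₁, s₂', b₂, b₃, t', b₄, b₅⟩⟩
    obtain rfl := H _ _ _ _ a₁.to_empty a₂.to_empty a₃ b₁.to_empty b₂.to_empty b₃
    have hc := (h₃ _ _ a₁.to_empty a₂.to_empty a₃).1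
    rw [CGS.succ_iff_of_controls hc CGS.setStrategy_same] at a₄ b₄
    exact b₅ (b₄ ▸ a₄ ▸ a₅)

theorem holds_cell (tb : TurnBased G) :
    Holds G (emptyCtx G) s (cell k) ↔ G.IsCell k s := by
  have hcore : ∀ t, Holds G (emptyCtx G) t (core k) ↔
      (Controls G 0 t ∧ (∃ m, G.label (G.trans t fun _ => m) (Formula.fnAtom 0)) ∧
      ∃ m, ¬ G.label (G.trans t fun _ => m) (Formula.fnAtom 0)) ∧
    (∀ i : Fin k, ∃ m, G.label (G.trans t fun _ => m) (Formula.fnAtom i)) ∧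
    ∀ s₃, G.Succ (emptyCtx G) t s₃ → Controls G 3 s₃ ∧
      (∃ m, G.label (G.trans s₃ fun _ => m) 0) ∧ ∃ m, ¬ G.label (G.trans s₃ fun _ => m) 0 := by
    intro t
    rw [core, holds_conj, holds_decides_atom tb, holds_conj, holds_allOf,
      holds_allNext (φ := decides _ _) ⟨trivial, trivial⟩]
    simp only [holds_decides_atom tb, List.forall_mem_map, List.mem_finRange, true_implies]
    refine and_congr_right fun h => ?_
    simp only [holds_force_atom h.1]
  rw [cell, holds_conj, holds_conj, holds_conj, holds_decides_atom tb,
    holds_allNext (φ := decides _ _) ⟨trivial, trivial⟩, holds_allNext (φ := allNext _) trivial]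
  simp only [holds_decides_atom tb, hcore, holds_disj, holds_neg, holds_atom,
    holds_allNext (φ := disj (neg (atom 2)) (core k)) ⟨trivial, isState_core⟩, ← imp_iff_not_or]
  constructor
  · rintro ⟨⟨h₁, h₂, h₃⟩, h₄, h₅, h₆⟩
    exact ⟨h₁, h₂, h₃, h₄, fun s₁ s₂ a b => h₅ s₁ a s₂ b,
      (holds_uniqueCore_iff h₁ (fun _ a => (h₄ _ a).1) fun s₁ s₂ a b c => (h₅ s₁ a s₂ b c).1).1 h₆⟩
  · intro h
    exact ⟨⟨h.controls, h.pos, h.neg⟩, h.side, fun s₁ a s₂ b => h.core s₁ s₂ a b,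
      (holds_uniqueCore_iff h.controls (fun _ a => (h.side _ a).1)
        fun s₁ s₂ a b c => (h.core s₁ s₂ a b c).1).2 h.unique⟩

end

end Formula

namespace CGS

variable {G : CGS} {ctx : Ctx G} {s s' : G.State} {k : ℕ}

theorem AppStep.to_empty {i : ℕ} (h : G.AppStep ctx i s s') : G.AppStep (emptyCtx G) i s s' := by
  obtain ⟨s₁, s₂, s₃, h₁, h₂, hC, h₃, hF, h₄, hA⟩ := h
  exact ⟨s₁, s₂, s₃, h₁.to_empty, h₂.to_empty, hC, h₃.to_empty, hF, h₄.to_empty, hA⟩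

theorem AppStep.reach {i : ℕ} (h : G.AppStep ctx i s s') : G.Reach ctx s s' := by
  obtain ⟨s₁, s₂, s₃, h₁, h₂, -, h₃, -, h₄, -⟩ := h
  exact .head h₁ (.head h₂ (.head h₃ (.single h₄)))

/-- Function values do not depend on the strategy of player `1`. -/
theorem IsCell.appStep_of_empty (hs : G.IsCell k s) (h0 : ctx 0 = none) (h3 : ctx 3 = none)
    {i : ℕ} (h : G.AppStep (emptyCtx G) i s s') : G.AppStep ctx i s s' := by
  obtain ⟨s₁, s₂, s₃, h₁, h₂, hC, h₃, hF, h₄, hA⟩ := h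
  obtain ⟨t₁, ht⟩ := exists_succ ctx s
  obtain ⟨hc, ⟨m, hm⟩, -⟩ := hs.side t₁ ht.to_empty
  obtain rfl := hs.unique _ _ _ _ h₁ h₂ hC ht.to_empty (succ_empty_const t₁ m) hm
  have hcore := hs.core _ _ h₁ h₂ hC
  exact ⟨t₁, _, s₃, ht, (succ_empty_const t₁ m).of_empty hc h3, hC, h₃.of_empty hcore.1.1 h0, hF,
    h₄.of_empty (hcore.2.2 _ h₃).1 h3, hA⟩

theorem IsCell.exists_appStep (hs : G.IsCell k s) (i : Fin k) :
    ∃ s', G.AppStep (emptyCtx G) i s s' := by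
  obtain ⟨t, ht⟩ := exists_succ (emptyCtx G) s
  obtain ⟨-, ⟨m, hm⟩, -⟩ := hs.side t ht
  obtain ⟨-, h₂, h₃⟩ := hs.core _ _ ht (succ_empty_const t m) hm
  obtain ⟨m', hm'⟩ := h₂ i
  obtain ⟨-, ⟨n, hn⟩, -⟩ := h₃ _ (succ_empty_const _ m')
  exact ⟨_, _, _, _, ht, succ_empty_const t m, hm, succ_empty_const _ m', hm',
    succ_empty_const _ n, hn⟩

/-- The structure `S` is represented inside the game structure `G`. -/
structure Realizes (G : CGS) (S : UnaryStruct k) (e : S.D → G.State) : Prop where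
  injective : Function.Injective e
  isCell : ∀ x, G.IsCell k (e x)
  appStep : ∀ x (i : Fin k) s', G.AppStep (emptyCtx G) i (e x) s' ↔ s' = e (S.fn i x)
  label : ∀ x n, G.label (e x) (Formula.labAtom n) ↔ S.lab x n

namespace Realizes

open Formula

variable {S : UnaryStruct k} {e : S.D → G.State}

theorem holds_exApp (h : Realizes G S e) (h0 : ctx 0 = none) (h3 : ctx 3 = none) (x : S.D)
    (i : Fin k) {φ : Formula} (hφ : φ.IsState) :
    Holds G ctx (e x) (exApp i φ) ↔ Holds G ctx (e (S.fn i x)) φ := by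
  rw [Formula.holds_exApp hφ]
  constructor
  · rintro ⟨s', hs, hφ⟩
    rwa [← (h.appStep _ _ _).1 hs.to_empty]
  · exact fun hφ => ⟨_, (h.isCell x).appStep_of_empty h0 h3 ((h.appStep _ _ _).2 rfl), hφ⟩

theorem holds_exWord (h : Realizes G S e) (h0 : ctx 0 = none) (h3 : ctx 3 = none) (x : S.D)
    (w : List (Fin k)) {φ : Formula} (hφ : φ.IsState) :
    Holds G ctx (e x) (exWord w φ) ↔ Holds G ctx (e (S.run w x)) φ := by
  induction w generalizing x with
  | nil => rfl
  | cons i w ih => rw [exWord, h.holds_exApp h0 h3 x i (isState_exWord w hφ), ih]; rfl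

theorem holds_wordEq (h : Realizes G S e) (x : S.D) (w w' : List (Fin k)) :
    Holds G (emptyCtx G) (e x) (wordEq w w') ↔ S.run w x = S.run w' x := by
  rw [wordEq, holds_forallStrategy (φ := .neg (conj (exWord w (exNext _)) (exWord w' (exNext _))))
    ⟨isState_exWord w (φ := exNext _) trivial, isState_exWord w' (φ := exNext _) trivial⟩]
  have key : ∀ σ, Holds G (G.setStrategy (emptyCtx G) 1 σ) (e x)
      (neg (conj (exWord w (exNext (Formula.atom 1))) (exWord w' (exNext (neg (Formula.atom 1))))))
      ↔ ¬ (G.label (G.trans (e (S.run w x)) fun _ => σ (e (S.run w x))) 1 ∧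
        ¬ G.label (G.trans (e (S.run w' x)) fun _ => σ (e (S.run w' x))) 1) := by
    intro σ
    rw [holds_neg, holds_conj, h.holds_exWord rfl rfl x w (φ := exNext _) trivial,
      h.holds_exWord rfl rfl x w' (φ := exNext _) trivial, holds_exNext_atom,
      holds_exNext_neg_atom]
    simp only [succ_iff_of_controls (h.isCell _).controls setStrategy_same, exists_eq_left]
  simp only [key]
  constructor
  · intro H
    by_contra hne
    obtain ⟨m, hm⟩ := (h.isCell (S.run w x)).pos
    obtain ⟨m', hm'⟩ := (h.isCell (S.run w' x)).neg
    obtain ⟨σ, rfl, rfl⟩ := exists_separating (h.injective.ne hne) m m'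
    exact H σ ⟨hm, hm'⟩
  · intro he σ
    rw [he]
    tauto

theorem holds_ofLoc (h : Realizes G S e) (φ : Loc k) (x : S.D) :
    Holds G (emptyCtx G) (e x) (ofLoc φ) ↔ φ.Eval S x := by
  induction φ generalizing x with
  | atom n => exact h.label x n
  | neg φ ih => exact not_congr (ih x)
  | conj φ ψ ihφ ihψ => exact and_congr (ihφ x) (ihψ x)
  | app i φ ih => rw [ofLoc, h.holds_exApp rfl rfl x i (isState_ofLoc φ), ih]; rfl
  | eq w w' => exact h.holds_wordEq x w w'

end Realizes

open Formula in
/-- If all function values are cells, `wordEq [i] [i]` states that the value is unique. -/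
theorem IsCell.eq_of_holds_wordEq (hs : G.IsCell k s) {i : Fin k}
    (hi : ∀ s', G.AppStep (emptyCtx G) i s s' → G.IsCell k s')
    (h : Holds G (emptyCtx G) s (wordEq [i] [i])) {t t' : G.State}
    (ht : G.AppStep (emptyCtx G) i s t) (ht' : G.AppStep (emptyCtx G) i s t') : t = t' := by
  by_contra hne
  obtain ⟨m, hm⟩ := (hi _ ht).pos
  obtain ⟨m', hm'⟩ := (hi _ ht').neg
  obtain ⟨σ, rfl, rfl⟩ := exists_separating hne m m'
  rw [wordEq, holds_forallStrategy
    (φ := .neg (conj (exWord [i] (exNext _)) (exWord [i] (exNext _)))) ⟨trivial, trivial⟩] at h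
  refine h σ ⟨(holds_exApp (φ := exNext _) trivial).2 ⟨t, hs.appStep_of_empty rfl rfl ht,
    holds_exNext_atom.2 ⟨_, ?_, hm⟩⟩, (holds_exApp (φ := exNext _) trivial).2
    ⟨t', hs.appStep_of_empty rfl rfl ht',
    holds_exNext_neg_atom.2 ⟨_, ?_, hm'⟩⟩⟩
  · exact (succ_iff_of_controls (hi _ ht).controls setStrategy_same).2 rfl
  · exact (succ_iff_of_controls (hi _ ht').controls setStrategy_same).2 rfl

end CGS

/-! ## Canonical game structures -/

namespace UnaryStruct

variable {k : ℕ} (S : UnaryStruct k)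

/-- The states of the game structure of a unary function structure. -/
inductive GameState (D : Type) : Type where
  | elem : D → GameState D
  | side : Bool → D → GameState D
  | core : D → GameState D
  | fnNode : ℕ → D → GameState D
  | junk : GameState D

/-- The game structure of a unary function structure. -/
def game : CGS where
  State := GameState S.D
  Move := ℕ
  move_nonempty := ⟨0⟩
  label
    | .elem x, a => a = 0 ∨ ∃ n, a = Formula.labAtom n ∧ S.lab x n
    | .side b _, a => a = 1 ∧ b = true
    | .core _, a => a = 2
    | .fnNode i _, a => a = Formula.fnAtom i
    | .junk, _ => False
  trans
    | .elem x, mv => .side (mv 1 == 0) x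
    | .side _ x, mv => if mv 3 = 0 then .core x else .junk
    | .core x, mv => .fnNode (mv 0) x
    | .fnNode i x, mv => if mv 3 = 0 then .elem (if h : i < k then S.fn ⟨i, h⟩ x else x) else .junk
    | .junk, _ => .junk

variable {S}

theorem controls_elem (x : S.D) : Controls S.game 1 (.elem x) := fun _ _ h =>
  congrArg (fun m : ℕ => GameState.side (m == 0) x) h

theorem controls_side (b : Bool) (x : S.D) : Controls S.game 3 (.side b x) := fun _ _ h =>
  congrArg (fun m : ℕ => if m = 0 then GameState.core x else .junk) h

theorem controls_core (x : S.D) : Controls S.game 0 (.core x) := fun _ _ h =>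
  congrArg (fun m : ℕ => GameState.fnNode m x) h

theorem controls_fnNode (i : ℕ) (x : S.D) : Controls S.game 3 (.fnNode i x) := fun _ _ h =>
  congrArg (fun m : ℕ => if m = 0 then GameState.elem (if h : i < k then S.fn ⟨i, h⟩ x else x)
    else .junk) h

variable (S) in
theorem game_turnBased : TurnBased S.game
  | .elem x => ⟨1, controls_elem x⟩
  | .side b x => ⟨3, controls_side b x⟩
  | .core x => ⟨0, controls_core x⟩
  | .fnNode i x => ⟨3, controls_fnNode i x⟩
  | .junk => ⟨0, fun _ _ _ => rfl⟩

theorem succ_elem {x : S.D} {s : S.game.State} :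
    S.game.Succ (emptyCtx _) (.elem x) s ↔ ∃ b, s = .side b x := by
  rw [CGS.succ_iff_of_controls_empty (controls_elem x)]
  constructor
  · rintro ⟨m, rfl⟩
    exact ⟨_, rfl⟩
  · rintro ⟨_ | _, rfl⟩
    exacts [⟨(1 : ℕ), rfl⟩, ⟨(0 : ℕ), rfl⟩]

theorem exists_trans_ite {α : Type} {f : ℕ → α} {s a b : α} (h0 : f 0 = a)
    (h1 : ∀ n, f (n + 1) = b) : (∃ m, s = f m) ↔ s = a ∨ s = b := by
  constructor
  · rintro ⟨_ | m, rfl⟩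
    exacts [.inl h0, .inr (h1 m)]
  · rintro (rfl | rfl)
    exacts [⟨0, h0.symm⟩, ⟨1, (h1 0).symm⟩]

theorem succ_side {b : Bool} {x : S.D} {s : S.game.State} :
    S.game.Succ (emptyCtx _) (.side b x) s ↔ s = .core x ∨ s = .junk := by
  rw [CGS.succ_iff_of_controls_empty (controls_side b x)]
  exact exists_trans_ite rfl fun n => rfl

theorem succ_core {x : S.D} {s : S.game.State} :
    S.game.Succ (emptyCtx _) (.core x) s ↔ ∃ i, s = .fnNode i x := by
  rw [CGS.succ_iff_of_controls_empty (controls_core x)]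
  rfl

theorem succ_fnNode {i : ℕ} {x : S.D} {s : S.game.State} :
    S.game.Succ (emptyCtx _) (.fnNode i x) s ↔
      s = .elem (if h : i < k then S.fn ⟨i, h⟩ x else x) ∨ s = .junk := by
  rw [CGS.succ_iff_of_controls_empty (controls_fnNode i x)]
  exact exists_trans_ite rfl fun n => rfl

theorem appStep_elem {x : S.D} {i : Fin k} {s : S.game.State} :
    S.game.AppStep (emptyCtx _) i (.elem x) s ↔ s = .elem (S.fn i x) := by
  constructor
  · rintro ⟨s₁, s₂, s₃, h₁, h₂, hC, h₃, hF, h₄, hA⟩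
    obtain ⟨b, rfl⟩ := succ_elem.1 h₁
    obtain rfl | rfl := succ_side.1 h₂
    · obtain ⟨j, rfl⟩ := succ_core.1 h₃
      obtain rfl : (i : ℕ) = j := by simpa [game, Formula.fnAtom] using hF
      obtain rfl | rfl := succ_fnNode.1 h₄
      · simp; rfl
      · exact hA.elim
    · exact hC.elim
  · rintro rfl
    exact ⟨_, _, _, succ_elem.2 ⟨true, rfl⟩, succ_side.2 (.inl rfl), rfl, succ_core.2 ⟨i, rfl⟩, rfl,
      succ_fnNode.2 (.inl (by simp; rfl)), .inl rfl⟩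

theorem isCell_elem (x : S.D) : S.game.IsCell k (.elem x) where
  controls := controls_elem x
  pos := ⟨(0 : ℕ), rfl, rfl⟩
  neg := ⟨(1 : ℕ), fun h => Bool.noConfusion h.2⟩
  side s₁ h₁ := by
    obtain ⟨b, rfl⟩ := succ_elem.1 h₁
    exact ⟨controls_side b x, ⟨(0 : ℕ), rfl⟩, (1 : ℕ), id⟩
  core s₁ s₂ h₁ h₂ hC := by
    obtain ⟨b, rfl⟩ := succ_elem.1 h₁
    obtain rfl | rfl := succ_side.1 h₂
    · refine ⟨⟨controls_core x, ⟨(0 : ℕ), rfl⟩, (1 : ℕ), by simp [game, Formula.fnAtom]⟩,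
        fun i => ⟨(i : ℕ), rfl⟩, fun s₃ h₃ => ?_⟩
      obtain ⟨j, rfl⟩ := succ_core.1 h₃
      exact ⟨controls_fnNode j x, ⟨(0 : ℕ), .inl rfl⟩, (1 : ℕ), id⟩
    · exact hC.elim
  unique s₁ s₂ s₁' s₂' a₁ a₂ a₃ b₁ b₂ b₃ := by
    obtain ⟨b, rfl⟩ := succ_elem.1 a₁
    obtain ⟨b', rfl⟩ := succ_elem.1 b₁
    obtain rfl | rfl := succ_side.1 a₂ <;> obtain rfl | rfl := succ_side.1 b₂
    exacts [rfl, b₃.elim, a₃.elim, rfl]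

theorem realizes_game : S.game.Realizes S .elem where
  injective _ _ h := by cases h; rfl
  isCell := isCell_elem
  appStep _ _ _ := appStep_elem
  label x n := by
    have : Formula.labAtom n ≠ 0 := by simp [Formula.labAtom]
    have inj : ∀ m, Formula.labAtom n = Formula.labAtom m ↔ n = m := by simp [Formula.labAtom]
    simp [game, this, inj]

end UnaryStruct

namespace Formula

variable {k : ℕ} {root glob : Loc k}

theorem isState_describe : (describe root glob).IsState :=
  ⟨⟨trivial, isState_ofLoc root⟩, trivial⟩

theorem holds_describe {G : CGS} (tb : TurnBased G) {s : G.State} :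
    Holds G (emptyCtx G) s (describe root glob) ↔
      (G.label s 0 ∧ Holds G (emptyCtx G) s (ofLoc root)) ∧
      ∀ s', G.Reach (emptyCtx G) s s' → G.label s' 0 →
        (G.IsCell k s' ∧ ∀ i : Fin k, Holds G (emptyCtx G) s' (wordEq [i] [i])) ∧
        Holds G (emptyCtx G) s' (ofLoc glob) := by
  rw [describe, holds_conj, holds_conj, holds_atom, holds_globally
    (φ := disj (neg (atom 0)) (conj (conj (cell k) (functional k)) (ofLoc glob))) 
    ⟨trivial, ⟨isState_cell, isState_functional⟩, isState_ofLoc glob⟩]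
  simp only [holds_disj, holds_neg, holds_conj, holds_atom, holds_cell tb, functional, holds_allOf,
    List.forall_mem_map, List.mem_finRange, true_implies, ← imp_iff_not_or]

/-- Satisfiability over turn-based games expresses satisfiability over unary function
structures. -/
theorem satTB_describe : SatTB (describe root glob) ↔
    ∃ (S : UnaryStruct k) (r : S.D), root.Eval S r ∧ ∀ x, glob.Eval S x := by
  constructor
  · rintro ⟨G, tb, r, h⟩
    have h : Holds G (emptyCtx G) r (describe root glob) := by
      obtain ⟨π, hπ⟩ := CGS.exists_outcome (emptyCtx G) r
      have := (sat_iff_holds isState_describe _).1 (h π hπ)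
      rwa [hπ.1] at this
    obtain ⟨⟨hA, hroot⟩, hG⟩ := (holds_describe tb).1 h
    let D := {s : G.State // G.Reach (emptyCtx G) r s ∧ G.label s 0}
    have hcell (x : D) : G.IsCell k x.1 := (hG _ x.2.1 x.2.2).1.1
    have hstep (x : D) (i : Fin k) (s' : G.State) (h : G.AppStep (emptyCtx G) i x.1 s') :
        G.Reach (emptyCtx G) r s' ∧ G.label s' 0 :=
      ⟨x.2.1.trans h.reach, by obtain ⟨_, _, _, _, _, _, _, _, _, h⟩ := h; exact h⟩
    choose f hf using fun (i : Fin k) (x : D) => (hcell x).exists_appStep i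
    let S : UnaryStruct k := ⟨D, fun i x => ⟨f i x, hstep x i _ (hf i x)⟩,
      fun x n => G.label x.1 (labAtom n)⟩
    have hS : G.Realizes S Subtype.val :=
      { injective := Subtype.val_injective
        isCell := hcell
        appStep := fun x i s' => by
          refine ⟨fun h => ?_, ?_⟩
          · exact (hcell x).eq_of_holds_wordEq (fun t ht => hcell ⟨t, hstep x i t ht⟩)
              ((hG _ x.2.1 x.2.2).1.2 i) h (hf i x)
          · rintro rfl
            exact hf i x
        label := fun x n => Iff.rfl }
    exact ⟨S, ⟨r, .refl, hA⟩, (hS.holds_ofLoc root ⟨r, .refl, hA⟩).1 hroot, fun x =>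
      (hS.holds_ofLoc glob x).1 (hG _ x.2.1 x.2.2).2⟩
  · rintro ⟨S, r, hroot, hglob⟩
    have hS := S.realizes_game
    refine ⟨S.game, S.game_turnBased, .elem r, fun π hπ => (sat_iff_holds isState_describe _).2 ?_⟩
    rw [hπ.1]
    refine (holds_describe S.game_turnBased).2 ⟨⟨.inl rfl, (hS.holds_ofLoc root r).2 hroot⟩, ?_⟩
    rintro (x | ⟨b, x⟩ | x | ⟨i, x⟩ | _) - hA
    · exact ⟨⟨hS.isCell x, fun i => (hS.holds_wordEq x _ _).2 rfl⟩,
        (hS.holds_ofLoc glob x).2 (hglob x)⟩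
    · simp [UnaryStruct.game] at hA
    · simp [UnaryStruct.game] at hA
    · simp [UnaryStruct.game, fnAtom] at hA
    · exact hA.elim

end Formula

/-! ## Derived local formulas and computability of their codes -/

namespace Loc

variable {k : ℕ}

/-- The true formula. -/
def tt : Loc k := neg (conj (atom 0) (neg (atom 0)))

/-- The disjunction of two local formulas. -/
def disj (φ ψ : Loc k) : Loc k := neg (conj (neg φ) (neg ψ))

/-- The conjunction of a list of local formulas. -/
def allOf (l : List (Loc k)) : Loc k := l.foldr conj tt

/-- The disjunction of a list of local formulas. -/
def anyOf (l : List (Loc k)) : Loc k := l.foldr disj (neg tt)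

section Eval

variable {S : UnaryStruct k} {x : S.D} {φ ψ : Loc k} {l : List (Loc k)}

@[simp] theorem eval_atom {n : ℕ} : (atom n).Eval S x ↔ S.lab x n := Iff.rfl

@[simp] theorem eval_neg : φ.neg.Eval S x ↔ ¬ φ.Eval S x := Iff.rfl

@[simp] theorem eval_conj : (conj φ ψ).Eval S x ↔ φ.Eval S x ∧ ψ.Eval S x := Iff.rfl

@[simp] theorem eval_app {i : Fin k} : (app i φ).Eval S x ↔ φ.Eval S (S.fn i x) := Iff.rfl

@[simp] theorem eval_eq {w w' : List (Fin k)} :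
    (eq w w').Eval S x ↔ S.run w x = S.run w' x := Iff.rfl

@[simp] theorem eval_tt : (tt : Loc k).Eval S x := by simp [tt]

@[simp] theorem eval_disj : (disj φ ψ).Eval S x ↔ φ.Eval S x ∨ ψ.Eval S x := by
  simp only [disj, eval_neg, eval_conj]
  tauto

theorem eval_allOf : (allOf l).Eval S x ↔ ∀ φ ∈ l, φ.Eval S x := by
  induction l with
  | nil => simp [allOf]
  | cons φ l ih => simp [allOf, ← ih]

theorem eval_anyOf : (anyOf l).Eval S x ↔ ∃ φ ∈ l, φ.Eval S x := by
  induction l with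
  | nil => simp [anyOf]
  | cons φ l ih => simp [anyOf, ← ih]

end Eval

/-- The number coding the translation of a local formula. -/
def code (φ : Loc k) : ℕ := encodeF (Formula.ofLoc φ)

/-- Local formulas given by a primitive recursive function. -/
def PrimrecCode {α : Type} [Primcodable α] (f : α → Loc k) : Prop := Primrec fun a => (f a).code

end Loc

theorem Primrec.natPair_comp {α : Type} [Primcodable α] {f g : α → ℕ} (hf : Primrec f)
    (hg : Primrec g) : Primrec fun a => Nat.pair (f a) (g a) := Primrec₂.natPair.comp hf hg

namespace Formula

/-- Game formulas given by a primitive recursive function. -/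
def PrimrecCode {α : Type} [Primcodable α] (f : α → Formula) : Prop :=
  Primrec fun a => encodeF (f a)

namespace PrimrecCode

variable {α : Type} [Primcodable α] {f g : α → Formula}

theorem const (φ : Formula) : PrimrecCode fun _ : α => φ := Primrec.const _

theorem neg (hf : PrimrecCode f) : PrimrecCode fun a => (f a).neg :=
  Primrec.natPair_comp (.const 1) hf

theorem conj (hf : PrimrecCode f) (hg : PrimrecCode g) : PrimrecCode fun a => (f a).conj (g a) :=
  Primrec.natPair_comp (.const 2) (Primrec.natPair_comp hf hg)

theorem disj (hf : PrimrecCode f) (hg : PrimrecCode g) : PrimrecCode fun a => (f a).disj (g a) :=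
  (hf.neg.conj hg.neg).neg

theorem exNext (hf : PrimrecCode f) : PrimrecCode fun a => (f a).exNext :=
  neg (Primrec.natPair_comp (.const 5) (Primrec.natPair_comp (.const _)
    (neg (Primrec.natPair_comp (.const 3) hf))))

theorem globally (hf : PrimrecCode f) : PrimrecCode fun a => (f a).globally :=
  Primrec.natPair_comp (.const 5) (Primrec.natPair_comp (.const _)
    (neg (Primrec.natPair_comp (.const 4) (Primrec.natPair_comp (.const _) hf.neg))))

theorem exApp (i : ℕ) (hf : PrimrecCode f) : PrimrecCode fun a => (f a).exApp i :=
  ((const _).conj ((const _).conj ((const _).conj hf).exNext).exNext).exNext.exNext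

theorem describe {k : ℕ} {root glob : α → Loc k} (hr : Loc.PrimrecCode root)
    (hg : Loc.PrimrecCode glob) : PrimrecCode fun a => describe (root a) (glob a) :=
  ((const _).conj hr).conj ((const _).disj ((const _).conj hg)).globally

end PrimrecCode

end Formula

namespace Loc.PrimrecCode

variable {k : ℕ} {α : Type} [Primcodable α] {f g : α → Loc k}

theorem const (φ : Loc k) : PrimrecCode fun _ : α => φ := Primrec.const _

theorem atom {f : α → ℕ} (hf : Primrec f) : PrimrecCode fun a => (.atom (f a) : Loc k) :=
  Primrec.natPair_comp (.const 0)
    (Primrec.nat_add.comp (Primrec.nat_mul.comp (.const 2) hf) (.const 3))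

theorem neg (hf : PrimrecCode f) : PrimrecCode fun a => (f a).neg := Formula.PrimrecCode.neg hf

theorem conj (hf : PrimrecCode f) (hg : PrimrecCode g) : PrimrecCode fun a => (f a).conj (g a) :=
  Formula.PrimrecCode.conj hf hg

theorem app (i : Fin k) (hf : PrimrecCode f) : PrimrecCode fun a => (f a).app i :=
  Formula.PrimrecCode.exApp i hf

theorem comp {β : Type} [Primcodable β] {h : β → α} (hf : PrimrecCode f) (hh : Primrec h) :
    PrimrecCode fun b => f (h b) := Primrec.comp (f := fun a => (f a).code) hf hh

variable {β : Type} [Primcodable β]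

theorem allOf_map {l : α → List β} {h : β → Loc k} (hl : Primrec l) (hh : PrimrecCode h) :
    PrimrecCode fun a => allOf ((l a).map h) := by
  have hstep : Primrec₂ fun (_ : α) (p : β × ℕ) => Nat.pair 2 (Nat.pair (h p.1).code p.2) :=
    Primrec.natPair_comp (.const 2) (Primrec.natPair_comp
      (Primrec.comp (f := fun b => (h b).code) hh (Primrec.fst.comp .snd)) (Primrec.snd.comp .snd))
  refine (Primrec.list_foldr hl (.const (tt : Loc k).code) hstep).of_eq fun a => ?_
  beta_reduce
  induction l a with
  | nil => rfl
  | cons b l ih => rw [List.foldr_cons, ih]; rfl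

theorem anyOf_map {l : α → List β} {h : β → Loc k} (hl : Primrec l) (hh : PrimrecCode h) :
    PrimrecCode fun a => anyOf ((l a).map h) := by
  have hstep : Primrec₂ fun (_ : α) (p : β × ℕ) => Nat.pair 1 (Nat.pair 2
      (Nat.pair (Nat.pair 1 (h p.1).code) (Nat.pair 1 p.2))) :=
    Primrec.natPair_comp (.const 1) (Primrec.natPair_comp (.const 2) (Primrec.natPair_comp
      (Primrec.natPair_comp (.const 1)
        (Primrec.comp (f := fun b => (h b).code) hh (Primrec.fst.comp .snd)))
      (Primrec.natPair_comp (.const 1) (Primrec.snd.comp .snd))))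
  refine (Primrec.list_foldr hl (.const (Loc.neg tt : Loc k).code) hstep).of_eq fun a => ?_
  beta_reduce
  induction l a with
  | nil => rfl
  | cons b l ih => rw [List.foldr_cons, ih]; rfl

end Loc.PrimrecCode

theorem encodeF_injective : Function.Injective encodeF := by
  intro φ
  induction φ with
  | atom n => intro ψ h; cases ψ <;> simp [encodeF] at h; rw [h]
  | neg φ ih => intro ψ h; cases ψ <;> simp [encodeF] at h; rw [ih h]
  | conj φ₁ φ₂ ih₁ ih₂ => intro ψ h; cases ψ <;> simp [encodeF] at h; rw [ih₁ h.1, ih₂ h.2]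
  | next φ ih => intro ψ h; cases ψ <;> simp [encodeF] at h; rw [ih h]
  | untl φ₁ φ₂ ih₁ ih₂ => intro ψ h; cases ψ <;> simp [encodeF] at h; rw [ih₁ h.1, ih₂ h.2]
  | strat A φ ih => intro ψ h; cases ψ <;> simp [encodeF] at h; rw [h.1, ih h.2]

/-! ## Tilings -/

namespace TileSystem

open Loc

/-- The least label of the current element is `t`. -/
def leastLabel (t : ℕ) : Loc 2 :=
  conj (atom t) (allOf ((List.range t).map fun i => neg (atom i)))

/-- The current element and its image under the `i`-th function carry tiles related by `R`. -/
def matching (i : Fin 2) (R : List (ℕ × ℕ)) : Loc 2 :=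
  anyOf (R.map fun p => conj (leastLabel p.1) (app i (leastLabel p.2)))

/-- The local formula describing tilings. -/
def tilingLoc (n : ℕ) (H V : List (ℕ × ℕ)) : Loc 2 :=
  conj (conj (eq [0, 1] [1, 0]) (anyOf ((List.range n).map leastLabel)))
    (conj (matching 0 H) (matching 1 V))

theorem eval_leastLabel {S : UnaryStruct 2} {x : S.D} {t : ℕ} :
    (leastLabel t).Eval S x ↔ S.lab x t ∧ ∀ i < t, ¬ S.lab x i := by
  simp [leastLabel, eval_allOf]

theorem leastLabel_unique {S : UnaryStruct 2} {x : S.D} {t t' : ℕ}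
    (h : (leastLabel t).Eval S x) (h' : (leastLabel t').Eval S x) : t = t' := by
  rw [eval_leastLabel] at h h'
  rcases lt_trichotomy t t' with hlt | rfl | hlt
  exacts [absurd h.1 (h'.2 _ hlt), rfl, absurd h'.1 (h.2 _ hlt)]

theorem eval_matching {S : UnaryStruct 2} {x : S.D} {i : Fin 2} {R : List (ℕ × ℕ)} :
    (matching i R).Eval S x ↔ ∃ a b, (a, b) ∈ R ∧ (leastLabel a).Eval S x ∧
      (leastLabel b).Eval S (S.fn i x) := by
  simp [matching, eval_anyOf]

theorem mem_of_eval_matching {S : UnaryStruct 2} {x : S.D} {i : Fin 2} {R : List (ℕ × ℕ)} {a b : ℕ}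
    (h : (matching i R).Eval S x) (ha : (leastLabel a).Eval S x)
    (hb : (leastLabel b).Eval S (S.fn i x)) : (a, b) ∈ R := by
  obtain ⟨a', b', hR, ha', hb'⟩ := eval_matching.1 h
  rwa [leastLabel_unique ha ha', leastLabel_unique hb hb']

theorem tilesQuadrant_iff (ts : TileSystem) : TilesQuadrant ts ↔
    SatTB (Formula.describe tt (tilingLoc ts.numTiles ts.H ts.V)) := by
  rw [Formula.satTB_describe]
  constructor
  · rintro ⟨τ, hn, hH, hV⟩
    let S : UnaryStruct 2 := ⟨ℕ × ℕ, ![fun x => (x.1 + 1, x.2), fun x => (x.1, x.2 + 1)],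
      fun x t => t = τ x.1 x.2⟩
    have hl (x : S.D) : (leastLabel (τ x.1 x.2)).Eval S x :=
      eval_leastLabel.2 ⟨rfl, fun i hi h => hi.ne h⟩
    refine ⟨S, (0, 0), eval_tt, fun x => ⟨⟨rfl, ?_⟩, ?_, ?_⟩⟩
    · simp only [eval_anyOf, List.mem_map, List.mem_range, exists_exists_and_eq_and]
      exact ⟨_, hn _ _, hl x⟩
    · exact eval_matching.2 ⟨_, _, hH x.1 x.2, hl x, hl (x.1 + 1, x.2)⟩
    · exact eval_matching.2 ⟨_, _, hV x.1 x.2, hl x, hl (x.1, x.2 + 1)⟩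
  · rintro ⟨S, r, -, h⟩
    have htile (x : S.D) : ∃ t < ts.numTiles, (leastLabel t).Eval S x := by
      simpa [eval_anyOf] using (h x).1.2
    choose tile hlt htile using htile
    have hcomm : Function.Commute (S.fn 1) (S.fn 0) := fun x => (h x).1.1
    have h0 (i j : ℕ) :
        (S.fn 0)^[i + 1] ((S.fn 1)^[j] r) = S.fn 0 ((S.fn 0)^[i] ((S.fn 1)^[j] r)) :=
      Function.iterate_succ_apply' _ _ _
    have h1 (i j : ℕ) :
        (S.fn 0)^[i] ((S.fn 1)^[j + 1] r) = S.fn 1 ((S.fn 0)^[i] ((S.fn 1)^[j] r)) := by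
      rw [Function.iterate_succ_apply']
      exact ((hcomm.iterate_right i) _).symm
    refine ⟨fun i j => tile ((S.fn 0)^[i] ((S.fn 1)^[j] r)), fun i j => hlt _, fun i j => ?_,
      fun i j => ?_⟩
    · beta_reduce
      rw [h0]
      exact mem_of_eval_matching (h _).2.1 (htile _) (htile _)
    · beta_reduce
      rw [h1]
      exact mem_of_eval_matching (h _).2.2 (htile _) (htile _)

theorem primrecCode_leastLabel : PrimrecCode leastLabel :=
  (PrimrecCode.atom .id).conj (.allOf_map .list_range (PrimrecCode.atom .id).neg)

theorem primrecCode_matching (i : Fin 2) : PrimrecCode (matching i) :=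
  .anyOf_map .id ((primrecCode_leastLabel.comp .fst).conj
    ((primrecCode_leastLabel.comp .snd).app i))

theorem primrecCode_tilingLoc :
    PrimrecCode fun p : ℕ × List (ℕ × ℕ) × List (ℕ × ℕ) => tilingLoc p.1 p.2.1 p.2.2 :=
  ((PrimrecCode.const _).conj (.anyOf_map (Primrec.list_range.comp .fst)
    primrecCode_leastLabel)).conj
    (((primrecCode_matching 0).comp (Primrec.fst.comp .snd)).conj
      ((primrecCode_matching 1).comp (Primrec.snd.comp .snd)))

theorem tilingProblem_reduces : TilingProblem ≤₀ SatTBProblem := by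
  let F (p : ℕ × List (ℕ × ℕ) × List (ℕ × ℕ)) : Formula :=
    .describe tt (tilingLoc p.1 p.2.1 p.2.2)
  let d (n : ℕ) := (Encodable.decode₂ (ℕ × List (ℕ × ℕ) × List (ℕ × ℕ)) n).getD (0, [], [])
  have hF : Primrec fun p => encodeF (F p) :=
    Formula.PrimrecCode.describe (PrimrecCode.const _) primrecCode_tilingLoc
  have hd : Primrec d := Primrec.option_getD.comp Primrec.decode₂ (.const _)
  have hsat (φ : Formula) : SatTBProblem (encodeF φ) ↔ SatTB φ :=
    ⟨fun ⟨ψ, h, hψ⟩ => encodeF_injective h ▸ hψ, fun h => ⟨φ, rfl, h⟩⟩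
  refine ⟨fun n => encodeF (F (d n)), (hF.comp hd).to_comp, fun n => ?_⟩
  rw [hsat, ← tilesQuadrant_iff ⟨(d n).1, (d n).2.1, (d n).2.2⟩]
  constructor
  · rintro ⟨ts, rfl, hts⟩
    have : d (encodeTS ts) = (ts.numTiles, ts.H, ts.V) := by
      simp only [d, encodeTS, Encodable.encodek₂, Option.getD_some]
    rwa [this]
  · intro h
    refine ⟨_, ?_, h⟩
    rcases hn : Encodable.decode₂ (ℕ × List (ℕ × ℕ) × List (ℕ × ℕ)) n with _ | p
    · obtain ⟨τ, hτ, -⟩ := h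
      simp [d, hn] at hτ
    · have : d n = p := by simp [d, hn]
      rw [this]
      exact Encodable.mem_decode₂.1 hn

end TileSystem

/-! ## Undecidability -/

namespace Halting

open Loc Turing.ToPartrec

/-- An injective numbering of codes. -/
def codeNum : Code → ℕ
  | .zero' => Nat.pair 0 0
  | .succ => Nat.pair 1 0
  | .tail => Nat.pair 2 0
  | .cons f g => Nat.pair 3 (Nat.pair (codeNum f) (codeNum g))
  | .comp f g => Nat.pair 4 (Nat.pair (codeNum f) (codeNum g))
  | .case f g => Nat.pair 5 (Nat.pair (codeNum f) (codeNum g))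
  | .fix f => Nat.pair 6 (codeNum f)

theorem codeNum_injective : Function.Injective codeNum := by
  intro c
  induction c with
  | zero' | succ | tail => intro d h; cases d <;> simp [codeNum] at h; rfl
  | cons f g ihf ihg | comp f g ihf ihg | case f g ihf ihg =>
    intro d h; cases d <;> simp [codeNum] at h; rw [ihf h.1, ihg h.2]
  | fix f ih => intro d h; cases d <;> simp [codeNum] at h; rw [ih h]

/-- The argument of a call. -/
abbrev arg : Fin 7 := 0
/-- The result of a call. -/
abbrev res : Fin 7 := 1
/-- The first recursive call. -/
abbrev sub₁ : Fin 7 := 2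
/-- The second recursive call. -/
abbrev sub₂ : Fin 7 := 3
/-- The head of a list. -/
abbrev hd : Fin 7 := 4
/-- The tail of a list. -/
abbrev tl : Fin 7 := 5
/-- The predecessor of a number. -/
abbrev pre : Fin 7 := 6

/-- The current call has a result. -/
def defined : Loc 7 := neg (atom 0)
/-- The current number is zero. -/
def isZero : Loc 7 := atom 1
/-- The current list is empty. -/
def isNil : Loc 7 := atom 2
/-- The current element is a call of `c`. -/
def isCall (c : Code) : Loc 7 := atom (codeNum c + 3)
/-- Implication of local formulas. -/
def imp (φ ψ : Loc 7) : Loc 7 := disj (neg φ) ψ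

/-- How the result of a call is obtained from its recursive calls. -/
def callRule : Code → Loc 7
  | .zero' => conj defined (conj (app res (app hd isZero)) (eq [res, tl] [arg]))
  | .succ => conj defined (conj (app res (app hd (neg isZero)))
      (conj (eq [res, hd, pre] [arg, hd]) (app res (app tl isNil))))
  | .tail => conj defined (eq [res] [arg, tl])
  | .cons f g => conj
      (conj (conj (app sub₁ (isCall f)) (eq [sub₁, arg] [arg]))
        (conj (app sub₂ (isCall g)) (eq [sub₂, arg] [arg])))
      (imp (conj (app sub₁ defined) (app sub₂ defined))
        (conj defined (conj (eq [res, hd] [sub₁, res, hd]) (eq [res, tl] [sub₂, res]))))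
  | .comp f g => conj
      (conj (conj (app sub₁ (isCall g)) (eq [sub₁, arg] [arg]))
        (conj (app sub₂ (isCall f)) (eq [sub₂, arg] [sub₁, res])))
      (imp (conj (app sub₁ defined) (app sub₂ defined)) (conj defined (eq [res] [sub₂, res])))
  | .case f g => conj
      (conj (imp (app arg (app hd isZero)) (conj (app sub₁ (isCall f)) (eq [sub₁, arg] [arg, tl])))
        (imp (app arg (app hd (neg isZero))) (conj (app sub₁ (isCall g))
          (conj (eq [sub₁, arg, hd] [arg, hd, pre]) (eq [sub₁, arg, tl] [arg, tl])))))
      (imp (app sub₁ defined) (conj defined (eq [res] [sub₁, res])))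
  | .fix f => conj
      (conj (conj (app sub₁ (isCall f)) (eq [sub₁, arg] [arg]))
        (conj (app sub₂ (isCall (.fix f))) (eq [sub₂, arg] [sub₁, res, tl])))
      (imp (app sub₁ defined) (conj
        (imp (app sub₁ (app res (app hd isZero))) (conj defined (eq [res] [sub₁, res, tl])))
        (imp (conj (app sub₁ (app res (app hd (neg isZero)))) (app sub₂ defined))
          (conj defined (eq [res] [sub₂, res])))))

/-- The rules for all calls of subcodes of a code. -/
def rules : Code → Loc 7
  | .cons f g => conj (imp (isCall (.cons f g)) (callRule (.cons f g))) (conj (rules f) (rules g))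
  | .comp f g => conj (imp (isCall (.comp f g)) (callRule (.comp f g))) (conj (rules f) (rules g))
  | .case f g => conj (imp (isCall (.case f g)) (callRule (.case f g))) (conj (rules f) (rules g))
  | .fix f => conj (imp (isCall (.fix f)) (callRule (.fix f))) (rules f)
  | c => imp (isCall c) (callRule c)

/-- Head and tail of the empty list. -/
def nilRule : Loc 7 := imp isNil (conj (app hd isZero) (app tl isNil))

/-- The current element represents the number `n`. -/
def isNum (n : ℕ) : Loc 7 := (fun φ => conj (neg isZero) (app pre φ))^[n] isZero

/-- The current element is a call of `c` on `[n]` without result. -/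
def undefinedCall (c : Code) (n : ℕ) : Loc 7 :=
  conj (conj (neg defined) (isCall c)) (app arg (conj (app hd (isNum n)) (app tl isNil)))

section Eval

variable {S : UnaryStruct 7} {x : S.D}

@[simp] theorem eval_imp {φ ψ : Loc 7} : (imp φ ψ).Eval S x ↔ (φ.Eval S x → ψ.Eval S x) := by
  simp [imp, imp_iff_not_or]

theorem callRule_of_rules {c : Code} (h : (rules c).Eval S x) (hx : (isCall c).Eval S x) :
    (callRule c).Eval S x := by
  cases c with
  | zero' | succ | tail => exact eval_imp.1 h hx
  | cons | comp | case | fix => exact eval_imp.1 h.1 hx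

theorem eval_callRule_case {f g : Code} : (callRule (.case f g)).Eval S x ↔
    ((isZero.Eval S (S.fn hd (S.fn arg x)) → (isCall f).Eval S (S.fn sub₁ x) ∧
        S.fn arg (S.fn sub₁ x) = S.fn tl (S.fn arg x)) ∧
      (¬ isZero.Eval S (S.fn hd (S.fn arg x)) → (isCall g).Eval S (S.fn sub₁ x) ∧
        S.fn hd (S.fn arg (S.fn sub₁ x)) = S.fn pre (S.fn hd (S.fn arg x)) ∧
        S.fn tl (S.fn arg (S.fn sub₁ x)) = S.fn tl (S.fn arg x))) ∧
    (defined.Eval S (S.fn sub₁ x) →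
      defined.Eval S x ∧ S.fn res x = S.fn res (S.fn sub₁ x)) := by
  simp only [callRule, eval_conj, eval_imp, eval_app, eval_neg, eval_eq, UnaryStruct.run_cons,
    UnaryStruct.run_nil]

theorem eval_rules (h : ∀ c, (isCall c).Eval S x → (callRule c).Eval S x) (c : Code) :
    (rules c).Eval S x := by
  induction c with
  | zero' | succ | tail => exact eval_imp.2 (h _)
  | cons f g ihf ihg | comp f g ihf ihg | case f g ihf ihg => exact ⟨eval_imp.2 (h _), ihf, ihg⟩
  | fix f ih => exact ⟨eval_imp.2 (h _), ih⟩

end Eval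

/-! ### Soundness -/

section Soundness

variable {S : UnaryStruct 7}

/-- The element `x` represents the list `v`. -/
def RepList (S : UnaryStruct 7) : S.D → List ℕ → Prop
  | x, [] => isNil.Eval S x
  | x, n :: v => (isNum n).Eval S (S.fn hd x) ∧ RepList S (S.fn tl x) v

theorem isNum_succ {x : S.D} {n : ℕ} :
    (isNum (n + 1)).Eval S x ↔ ¬ isZero.Eval S x ∧ (isNum n).Eval S (S.fn pre x) := by
  rw [isNum, Function.iterate_succ_apply']
  rfl

theorem isNum_isZero_iff {x : S.D} {n : ℕ} (h : (isNum n).Eval S x) :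
    isZero.Eval S x ↔ n = 0 := by
  cases n with
  | zero => exact iff_of_true h rfl
  | succ n => exact iff_of_false (isNum_succ.1 h).1 (by simp)

theorem RepList.head {x : S.D} {v : List ℕ} (hnil : ∀ x, nilRule.Eval S x) (h : RepList S x v) :
    (isNum v.headI).Eval S (S.fn hd x) := by
  cases v with
  | nil => exact (eval_imp.1 (hnil x) h).1
  | cons n v => exact h.1

theorem RepList.tail {x : S.D} {v : List ℕ} (hnil : ∀ x, nilRule.Eval S x) (h : RepList S x v) :
    RepList S (S.fn tl x) v.tail := by
  cases v with
  | nil => exact (eval_imp.1 (hnil x) h).2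
  | cons n v => exact h.2

/-- The rules force all calls with a value to have this value as result. -/
theorem defined_of_mem_eval (hnil : ∀ x, nilRule.Eval S x) (c : Code)
    (hc : ∀ x, (rules c).Eval S x) (x : S.D) (v w : List ℕ) (hx : (isCall c).Eval S x)
    (hv : RepList S (S.fn arg x) v) (hw : w ∈ c.eval v) :
    defined.Eval S x ∧ RepList S (S.fn res x) w := by
  induction c generalizing x v w with
  | zero' =>
    obtain ⟨h₁, h₂, h₃⟩ := callRule_of_rules (hc x) hx
    obtain rfl : w = 0 :: v := by simpa using hw
    simp only [eval_eq, UnaryStruct.run_cons, UnaryStruct.run_nil] at h₃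
    exact ⟨h₁, h₂, h₃ ▸ hv⟩
  | succ =>
    obtain ⟨h₁, h₂, h₃, h₄⟩ := callRule_of_rules (hc x) hx
    obtain rfl : w = [v.headI.succ] := by simpa using hw
    simp only [eval_eq, UnaryStruct.run_cons, UnaryStruct.run_nil] at h₃
    exact ⟨h₁, isNum_succ.2 ⟨h₂, h₃ ▸ hv.head hnil⟩, h₄⟩
  | tail =>
    obtain ⟨h₁, h₂⟩ := callRule_of_rules (hc x) hx
    obtain rfl : w = v.tail := by simpa using hw
    simp only [eval_eq, UnaryStruct.run_cons, UnaryStruct.run_nil] at h₂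
    exact ⟨h₁, h₂ ▸ hv.tail hnil⟩
  | cons f g ihf ihg =>
    have h := callRule_of_rules (hc x) hx
    simp only [callRule, eval_conj, eval_imp, eval_app, eval_eq, UnaryStruct.run_cons,
      UnaryStruct.run_nil] at h
    obtain ⟨⟨⟨a₁, a₂⟩, b₁, b₂⟩, h⟩ := h
    simp only [Code.cons_eval, Part.bind_eq_bind, Part.mem_bind_iff, Part.pure_eq_some,
      Part.mem_some_iff] at hw
    obtain ⟨u, hu, u', hu', rfl⟩ := hw
    obtain ⟨c₁, c₂⟩ := ihf (fun x => (hc x).2.1) _ v u a₁ (a₂ ▸ hv) hu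
    obtain ⟨d₁, d₂⟩ := ihg (fun x => (hc x).2.2) _ v u' b₁ (b₂ ▸ hv) hu'
    obtain ⟨e₁, e₂, e₃⟩ := h ⟨c₁, d₁⟩
    exact ⟨e₁, e₂ ▸ c₂.head hnil, e₃ ▸ d₂⟩
  | comp f g ihf ihg =>
    have h := callRule_of_rules (hc x) hx
    simp only [callRule, eval_conj, eval_imp, eval_app, eval_eq, UnaryStruct.run_cons,
      UnaryStruct.run_nil] at h
    obtain ⟨⟨⟨a₁, a₂⟩, b₁, b₂⟩, h⟩ := h
    rw [Code.comp_eval] at hw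
    obtain ⟨u, hu, hw⟩ := Part.mem_bind_iff.1 hw
    obtain ⟨c₁, c₂⟩ := ihg (fun x => (hc x).2.2) _ v u a₁ (a₂ ▸ hv) hu
    obtain ⟨d₁, d₂⟩ := ihf (fun x => (hc x).2.1) _ u w b₁ (b₂ ▸ c₂) hw
    obtain ⟨e₁, e₂⟩ := h ⟨c₁, d₁⟩
    exact ⟨e₁, e₂ ▸ d₂⟩
  | case f g ihf ihg =>
    have h := callRule_of_rules (hc x) hx
    simp only [eval_callRule_case, isNum_isZero_iff (hv.head hnil)] at h
    obtain ⟨⟨a, b⟩, h⟩ := h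
    have key : defined.Eval S (S.fn sub₁ x) ∧ RepList S (S.fn res (S.fn sub₁ x)) w := by
      rw [Code.case_eval] at hw
      beta_reduce at hw
      have hh := hv.head hnil
      rcases hn : v.headI with _ | n
      · rw [hn] at hw
        obtain ⟨a₁, a₂⟩ := a hn
        exact ihf (fun x => (hc x).2.1) _ v.tail w a₁ (a₂ ▸ hv.tail hnil) hw
      · rw [hn] at hw hh
        obtain ⟨b₁, b₂, b₃⟩ := b (by simp [hn])
        exact ihg (fun x => (hc x).2.2) _ (n :: v.tail) w b₁
          ⟨b₂ ▸ (isNum_succ.1 hh).2, b₃ ▸ hv.tail hnil⟩ hw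
    obtain ⟨e₁, e₂⟩ := h key.1
    exact ⟨e₁, e₂ ▸ key.2⟩
  | fix f ih =>
    rw [Code.fix_eval] at hw
    revert x
    refine PFun.fixInduction hw fun v hw IH x hx hv => ?_
    have h := callRule_of_rules (hc x) hx
    simp only [callRule, eval_conj, eval_imp, eval_app, eval_neg, eval_eq, UnaryStruct.run_cons,
      UnaryStruct.run_nil] at h
    obtain ⟨⟨⟨a₁, a₂⟩, b₁, b₂⟩, h⟩ := h
    replace hw := PFun.mem_fix_iff.1 hw
    simp only [Part.mem_map_iff] at hw IH
    have key : ∃ u ∈ f.eval v, (u.headI = 0 ∧ u.tail = w) ∨ (u.headI ≠ 0 ∧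
        w ∈ PFun.fix (fun v => (f.eval v).map fun v =>
          if v.headI = 0 then Sum.inl v.tail else Sum.inr v.tail) u.tail) := by
      rcases hw with ⟨u, hu, hw⟩ | ⟨v', ⟨u, hu, hv'⟩, hw⟩ <;> refine ⟨u, hu, ?_⟩ <;>
        split_ifs at * <;> simp_all
    obtain ⟨u, hu, hw⟩ := key
    obtain ⟨c₁, c₂⟩ := ih (fun x => (hc x).2) _ v u a₁ (a₂ ▸ hv) hu
    rw [isNum_isZero_iff (c₂.head hnil)] at h
    obtain ⟨h₁, h₂⟩ := h c₁
    rcases hw with ⟨h0, rfl⟩ | ⟨h0, hw⟩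
    · obtain ⟨e₁, e₂⟩ := h₁ h0
      exact ⟨e₁, e₂ ▸ c₂.tail hnil⟩
    · obtain ⟨d₁, d₂⟩ := IH u.tail ⟨u, hu, by simp [h0]⟩ _ b₁ (b₂ ▸ c₂.tail hnil)
      obtain ⟨e₁, e₂⟩ := h₂ ⟨h0, d₁⟩
      exact ⟨e₁, e₂ ▸ d₂⟩

end Soundness

/-! ### The model of all calls -/

/-- Calls, lists and numbers. -/
inductive Elem : Type where
  | call : Code → List ℕ → Elem
  | list : List ℕ → Elem
  | num : ℕ → Elem

open Classical in
/-- The value of a call, or the empty list if it is undefined. -/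
noncomputable def value (c : Code) (v : List ℕ) : List ℕ :=
  if h : (c.eval v).Dom then (c.eval v).get h else []

theorem value_mem {c : Code} {v : List ℕ} (h : (c.eval v).Dom) : value c v ∈ c.eval v := by
  rw [value, dif_pos h]
  exact Part.get_mem h

theorem dom_and_value_eq {c : Code} {v w : List ℕ} (h : w ∈ c.eval v) :
    (c.eval v).Dom ∧ value c v = w :=
  ⟨Part.dom_iff_mem.2 ⟨w, h⟩, Part.mem_unique (value_mem (Part.dom_iff_mem.2 ⟨w, h⟩)) h⟩

/-- The functions of the model. -/
noncomputable def modelFn : Fin 7 → Elem → Elem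
  | 0, .call _ v => .list v
  | 1, .call c v => .list (value c v)
  | 2, .call (.cons f _) v => .call f v
  | 2, .call (.comp _ g) v => .call g v
  | 2, .call (.case f g) v =>
      if v.headI = 0 then .call f v.tail else .call g (v.headI.pred :: v.tail)
  | 2, .call (.fix f) v => .call f v
  | 3, .call (.cons _ g) v => .call g v
  | 3, .call (.comp f g) v => .call f (value g v)
  | 3, .call (.fix f) v => .call (.fix f) (value f v).tail
  | 4, .list v => .num v.headI
  | 5, .list v => .list v.tail
  | 6, .num n => .num n.pred
  | _, x => x

/-- The model of all calls. -/
noncomputable abbrev model : UnaryStruct 7 where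
  D := Elem
  fn := modelFn
  lab
    | .call c v, n => (n = 0 ∧ ¬ (c.eval v).Dom) ∨ n = codeNum c + 3
    | .list v, n => n = 2 ∧ v = []
    | .num m, n => n = 1 ∧ m = 0

section Model

@[simp] theorem isCall_call {c d : Code} {v : List ℕ} :
    (isCall c).Eval model (Elem.call d v) ↔ c = d := by
  simp [isCall, model, codeNum_injective.eq_iff]

@[simp] theorem defined_call {c : Code} {v : List ℕ} :
    defined.Eval model (Elem.call c v) ↔ (c.eval v).Dom := by
  simp [defined, model]

@[simp] theorem isZero_num {n : ℕ} : isZero.Eval model (Elem.num n) ↔ n = 0 := by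
  simp [isZero, model]

@[simp] theorem isNil_list {v : List ℕ} : isNil.Eval model (Elem.list v) ↔ v = [] := by
  simp [isNil, model]

theorem isNum_num (n : ℕ) : (isNum n).Eval model (Elem.num n) := by
  induction n with
  | zero => exact isZero_num.2 rfl
  | succ n ih => exact isNum_succ.2 ⟨by simp, ih⟩

theorem model_nilRule (x : model.D) : nilRule.Eval model x := by
  refine eval_imp.2 fun h => ?_
  obtain (⟨c, v⟩ | v | n) := x
  · simp [isNil, model] at h
  · obtain rfl := isNil_list.1 h
    exact ⟨isZero_num.2 rfl, isNil_list.2 rfl⟩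
  · simp [isNil, model] at h

theorem model_callRule (c : Code) (v : List ℕ) : (callRule c).Eval model (Elem.call c v) := by
  cases c with
  | zero' =>
    obtain ⟨h, e⟩ := dom_and_value_eq (c := .zero') (v := v) (w := 0 :: v) (by simp)
    refine ⟨defined_call.2 h, isZero_num.2 ?_, congrArg Elem.list ?_⟩ <;> simp [e]
  | succ =>
    obtain ⟨h, e⟩ := dom_and_value_eq (c := .succ) (v := v) (w := [v.headI.succ]) (by simp)
    refine ⟨defined_call.2 h, mt isZero_num.1 ?_, congrArg Elem.num ?_, isNil_list.2 ?_⟩ <;>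
      simp [e]
  | tail =>
    obtain ⟨h, e⟩ := dom_and_value_eq (c := .tail) (v := v) (w := v.tail) (by simp)
    exact ⟨defined_call.2 h, congrArg Elem.list e⟩
  | cons f g =>
    refine ⟨⟨⟨isCall_call.2 rfl, rfl⟩, isCall_call.2 rfl, rfl⟩, eval_imp.2 fun ⟨hf, hg⟩ => ?_⟩
    obtain ⟨h, e⟩ := dom_and_value_eq (c := .cons f g) (v := v)
      (w := (value f v).headI :: value g v) (by
        simp only [Code.cons_eval, Part.bind_eq_bind, Part.mem_bind_iff, Part.pure_eq_some,
          Part.mem_some_iff]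
        exact ⟨_, value_mem (defined_call.1 hf), _, value_mem (defined_call.1 hg), rfl⟩)
    refine ⟨defined_call.2 h, congrArg Elem.num ?_, congrArg Elem.list ?_⟩ <;> simp [e]
  | comp f g =>
    refine ⟨⟨⟨isCall_call.2 rfl, rfl⟩, isCall_call.2 rfl, rfl⟩, eval_imp.2 fun ⟨hg, hf⟩ => ?_⟩
    obtain ⟨h, e⟩ := dom_and_value_eq (c := .comp f g) (v := v) (w := value f (value g v)) (by
      rw [Code.comp_eval]
      exact Part.mem_bind_iff.2
        ⟨_, value_mem (defined_call.1 hg), value_mem (defined_call.1 hf)⟩)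
    exact ⟨defined_call.2 h, congrArg Elem.list e⟩
  | case f g =>
    refine eval_callRule_case.2 ?_
    rcases hn : v.headI with _ | n
    · have hs : model.fn sub₁ (Elem.call (.case f g) v) = Elem.call f v.tail := if_pos hn
      rw [hs]
      refine ⟨⟨fun _ => ⟨isCall_call.2 rfl, rfl⟩, fun h => (h (isZero_num.2 hn)).elim⟩,
        fun hf => ?_⟩
      obtain ⟨h, e⟩ := dom_and_value_eq (c := .case f g) (v := v) (w := value f v.tail) (by
        rw [Code.case_eval]
        simpa [hn] using value_mem (defined_call.1 hf))
      exact ⟨defined_call.2 h, congrArg Elem.list e⟩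
    · have hs : model.fn sub₁ (Elem.call (.case f g) v) = Elem.call g (n :: v.tail) := by
        refine (if_neg (by simp [hn])).trans ?_
        rw [hn]
        rfl
      rw [hs]
      refine ⟨⟨fun h => ?_, fun _ => ⟨isCall_call.2 rfl, congrArg Elem.num ?_, rfl⟩⟩,
        fun hg => ?_⟩
      · have := isZero_num.1 h
        simp [hn] at this
      · simp [hn]
      obtain ⟨h, e⟩ := dom_and_value_eq (c := .case f g) (v := v) (w := value g (n :: v.tail)) (by
        rw [Code.case_eval]
        simpa [hn] using value_mem (defined_call.1 hg))
      exact ⟨defined_call.2 h, congrArg Elem.list e⟩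
  | fix f =>
    refine ⟨⟨⟨isCall_call.2 rfl, rfl⟩, isCall_call.2 rfl, rfl⟩, eval_imp.2 fun hf =>
      ⟨eval_imp.2 fun h0 => ?_, eval_imp.2 fun ⟨h0, h₂⟩ => ?_⟩⟩
    · obtain ⟨h, e⟩ := dom_and_value_eq (c := .fix f) (v := v) (w := (value f v).tail) (by
        rw [Code.fix_eval]
        exact PFun.mem_fix_iff.2 (.inl (Part.mem_map_iff _ |>.2
          ⟨_, value_mem (defined_call.1 hf), if_pos (isZero_num.1 h0)⟩)))
      exact ⟨defined_call.2 h, congrArg Elem.list e⟩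
    · obtain ⟨h, e⟩ := dom_and_value_eq (c := .fix f) (v := v)
        (w := value (.fix f) (value f v).tail) (by
          have := value_mem (defined_call.1 h₂)
          rw [Code.fix_eval] at this ⊢
          exact PFun.mem_fix_iff.2 (.inr ⟨_, Part.mem_map_iff _ |>.2
            ⟨_, value_mem (defined_call.1 hf), if_neg (mt isZero_num.2 h0)⟩, this⟩))
      exact ⟨defined_call.2 h, congrArg Elem.list e⟩

theorem model_rules (c : Code) (x : model.D) : (rules c).Eval model x := by
  refine eval_rules (fun d h => ?_) c
  obtain (⟨c, v⟩ | v | n) := x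
  · obtain rfl := isCall_call.1 h
    exact model_callRule d v
  · simp [isCall, model] at h
  · simp [isCall, model] at h

end Model

theorem satTB_iff_not_dom (c : Code) (n : ℕ) :
    SatTB (Formula.describe (undefinedCall c n) (conj nilRule (rules c))) ↔
      ¬ (c.eval [n]).Dom := by
  rw [Formula.satTB_describe]
  constructor
  · rintro ⟨S, x, ⟨⟨hx, hc⟩, hv⟩, h⟩ hdom
    exact hx (defined_of_mem_eval (fun x => (h x).1) c (fun x => (h x).2) x [n] _ hc hv
      (Part.get_mem hdom)).1
  · intro h
    exact ⟨model, Elem.call c [n], ⟨⟨mt defined_call.1 h, isCall_call.2 rfl⟩,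
      isNum_num n, isNil_list.2 rfl⟩, fun x => ⟨model_nilRule x, model_rules c x⟩⟩

/-- The code of the conjunction of two formulas. -/
def conjCode (m n : ℕ) : ℕ := Nat.pair 2 (Nat.pair m n)

/-- The action of `Formula.exNext` on codes. -/
def exNextCode (n : ℕ) : ℕ :=
  Nat.pair 1 (Nat.pair 5 (Nat.pair (Encodable.encode ([] : List ℕ)) (Nat.pair 1 (Nat.pair 3 n))))

/-- The action of the step in the definition of `isNum` on codes. -/
def isNumStepCode (n : ℕ) : ℕ :=
  conjCode (neg isZero).code (exNextCode (exNextCode (conjCode (encodeF (.atom 2))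
    (exNextCode (conjCode (encodeF (.atom (Formula.fnAtom 6)))
      (exNextCode (conjCode (encodeF (.atom 0)) n)))))))

theorem code_isNum_step (φ : Loc 7) :
    (conj (neg isZero) (app pre φ)).code = isNumStepCode φ.code := rfl

theorem primrec_isNumStepCode : Primrec isNumStepCode := by
  have hc (m : ℕ) : Primrec (conjCode m) :=
    Primrec.natPair_comp (.const 2) (Primrec.natPair_comp (.const m) .id)
  have he : Primrec exNextCode :=
    Primrec.natPair_comp (.const 1) (Primrec.natPair_comp (.const 5) (Primrec.natPair_comp
      (.const _) (Primrec.natPair_comp (.const 1) (Primrec.natPair_comp (.const 3) .id))))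
  exact (hc _).comp (he.comp (he.comp ((hc _).comp (he.comp ((hc _).comp (he.comp (hc _)))))))

theorem primrecCode_isNum : PrimrecCode isNum := by
  have hstep : Primrec₂ fun _ n : ℕ => isNumStepCode n := primrec_isNumStepCode.comp .snd
  refine (Primrec.nat_iterate .id (.const isZero.code) hstep).of_eq fun n => ?_
  induction n with
  | zero => rfl
  | succ n ih =>
    rw [isNum, Function.iterate_succ_apply', code_isNum_step]
    exact (Function.iterate_succ_apply' _ _ _).trans (congrArg isNumStepCode ih)

theorem primrecCode_undefinedCall (c : Code) : PrimrecCode (undefinedCall c) :=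
  (PrimrecCode.const _).conj (((primrecCode_isNum.app hd).conj (.const _)).app arg)

/-- A code halting on a number if and only if the program with this number halts on `0`. -/
theorem exists_universal_code : ∃ c : Code, ∀ n : ℕ, (c.eval [n]).Dom ↔
    ((Denumerable.ofNat Nat.Partrec.Code n).eval 0).Dom := by
  have h : Partrec fun n : ℕ => (Denumerable.ofNat Nat.Partrec.Code n).eval 0 :=
    Nat.Partrec.Code.eval_part.comp (Computable.ofNat _) (Computable.const 0)
  obtain ⟨c, hc⟩ := Code.exists_code (Nat.Partrec'.part_iff₁.2 h)
  refine ⟨c, fun n => ?_⟩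
  have := hc ⟨[n], rfl⟩
  rw [this]
  rfl

theorem not_decidable_satTB : ¬ ∃ f : ℕ → Bool, Computable f ∧
    ∀ φ : Formula, (f (encodeF φ) = true ↔ SatTB φ) := by
  rintro ⟨f, hf, h⟩
  obtain ⟨c, hc⟩ := exists_universal_code
  let F (n : ℕ) : Formula := .describe (undefinedCall c n) (conj nilRule (rules c))
  have hF : Primrec fun n => encodeF (F n) :=
    Formula.PrimrecCode.describe (primrecCode_undefinedCall c) (.const _)
  refine ComputablePred.halting_problem 0 (ComputablePred.computable_iff.2
    ⟨fun p => !f (encodeF (F (Encodable.encode p))), ?_, funext fun p => propext ?_⟩)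
  · exact Primrec.not.to_comp.comp (hf.comp (hF.to_comp.comp Computable.encode))
  · have := (h (F (Encodable.encode p))).trans (satTB_iff_not_dom c _)
    rw [hc, Denumerable.ofNat_encode] at this
    rw [Bool.not_eq_true', ← Bool.not_eq_true, this, not_not]

end Halting

/-- **Theorem.** Satisfiability of ATL_sc^0 with memoryless-strategy quantification
over (possibly infinite-state) turn-based game structures is undecidable: the problem
of tiling the quadrant ℕ×ℕ many-one reduces to it (and hence it admits no decision
algorithm). -/
theorem tiling_manyOneReduces_to_ATLsc0_satisfiability :
    TilingProblem ≤₀ SatTBProblem ∧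
    ¬ ∃ f : ℕ → Bool, Computable f ∧
      ∀ φ : Formula, (f (encodeF φ) = true ↔ SatTB φ) := by
  exact ⟨TileSystem.tilingProblem_reduces, Halting.not_decidable_satTB⟩
end
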